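/- arXiv:1912.00620 — 11 statements merged into one kernel-verified Lean document; each statement's English description precedes it below -/
import Mathlib

section
/- Let (A1, A2) be an r×n matrix pair over a field K with common column set E, and let (X_j)_{j∈E} be distinct indeterminates. Then (A1, A2) has a common base if and only if the determinant of the matrix A1 · D(X) · A2ᵀ, regarded as a matrix over the multivariate polynomial ring K[X_j : j ∈ E], is nonzero. -/
open Matrix

/-- The square submatrix of `A` formed by the columns in `B` taken in increasing order
(junk value `0` if `B.card ≠ r`). -/
noncomputable def colSub {R : Type*} [CommRing R] {r : ℕ} {E : Type*} [Fintype E] [LinearOrder E]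
    (A : Matrix (Fin r) E R) (B : Finset E) : Matrix (Fin r) (Fin r) R :=
  if h : B.card = r then A.submatrix id (fun i => B.orderEmbOfFin h i) else 0


theorem det_mul_expand {R : Type*} [CommRing R] {r : ℕ} {E : Type*} [Fintype E]
    (M : Matrix (Fin r) E R) (N : Matrix E (Fin r) R) :
    (M * N).det = ∑ p : Fin r → E, (M.submatrix id p).det * ∏ i, N (p i) i := by
  classical
  simp only [det_apply', mul_apply, Finset.prod_univ_sum, Finset.mul_sum, Fintype.piFinset_univ,
    Finset.sum_mul]
  rw [Finset.sum_comm]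
  refine Finset.sum_congr rfl fun p _ => Finset.sum_congr rfl fun σ _ => ?_
  simp [Finset.prod_mul_distrib, mul_assoc]

theorem det_indicator {K : Type*} [Field K] {r : ℕ} {E : Type*}
    [Fintype E] [LinearOrder E] (A1 A2 : Matrix (Fin r) E K) (B : Finset E) (hB : B.card = r) :
    (A1 * Matrix.diagonal (fun j => if j ∈ B then (1 : K) else 0) * A2ᵀ).det
      = (colSub A1 B).det * (colSub A2 B).det := by
  rw [← det_transpose (colSub A2 B), ← det_mul]
  congr 1
  ext i k
  rw [mul_apply, mul_apply]
  simp only [colSub, hB, dif_pos, mul_diagonal, transpose_apply, submatrix_apply, id]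
  simp only [mul_ite, mul_one, mul_zero, ite_mul, zero_mul]
  rw [Finset.sum_ite_mem, Finset.univ_inter]
  conv_lhs => rw [← Finset.map_orderEmbOfFin_univ B hB]
  rw [Finset.sum_map]
  rfl

theorem evalDiag_det {K : Type*} [Field K] {r : ℕ} {E : Type*}
    [Fintype E] [LinearOrder E] (A1 A2 : Matrix (Fin r) E K) (z : E → K) :
    MvPolynomial.eval z (A1.map (MvPolynomial.C (σ := E)) *
          Matrix.diagonal (fun j => (MvPolynomial.X j : MvPolynomial E K)) *
          (A2.map (MvPolynomial.C (σ := E)))ᵀ).det = (A1 * Matrix.diagonal z * A2ᵀ).det := by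
  rw [RingHom.map_det]
  congr 1
  ext i k
  simp only [RingHom.mapMatrix_apply, map_apply]
  rw [mul_apply, mul_apply, map_sum]
  simp [mul_diagonal]

theorem det_expand {K : Type*} [Field K] {r : ℕ} {E : Type*}
    [Fintype E] [LinearOrder E] (A1 A2 : Matrix (Fin r) E K) :
    (A1.map (MvPolynomial.C (σ := E)) *
          Matrix.diagonal (fun j => (MvPolynomial.X j : MvPolynomial E K)) *
          (A2.map (MvPolynomial.C (σ := E)))ᵀ).det
    = ∑ p : Fin r → E, MvPolynomial.monomial (∑ i, Finsupp.single (p i) 1)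
        ((A1.submatrix id p).det * ∏ i, A2 i (p i)) := by
  rw [Matrix.mul_assoc, det_mul_expand]
  refine Finset.sum_congr rfl fun p _ => ?_
  have h : ((A1.map (MvPolynomial.C (σ := E))).submatrix id p).det
      = MvPolynomial.C (A1.submatrix id p).det := by
    rw [RingHom.map_det]; rfl
  rw [h]
  simp only [diagonal_mul, transpose_apply, map_apply, Finset.prod_mul_distrib]
  rw [← mul_one ((A1.submatrix id p).det * _), ← MvPolynomial.C_mul_monomial,
    MvPolynomial.monomial_sum_one, map_mul, map_prod]
  simp only [MvPolynomial.X]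
  ring

theorem commonBase_exists_iff_det_ne_zero {K : Type*} [Field K] {r : ℕ} {E : Type*}
    [Fintype E] [LinearOrder E] (A1 A2 : Matrix (Fin r) E K) :
    (∃ B : Finset E, B.card = r ∧ (colSub A1 B).det ≠ 0 ∧ (colSub A2 B).det ≠ 0)
      ↔ (A1.map (MvPolynomial.C (σ := E)) *
          Matrix.diagonal (fun j => (MvPolynomial.X j : MvPolynomial E K)) *
          (A2.map (MvPolynomial.C (σ := E)))ᵀ).det ≠ 0 := by
  constructor
  · rintro ⟨B, hB, h1, h2⟩ h0
    have h := evalDiag_det A1 A2 (fun j => if j ∈ B then (1 : K) else 0)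
    rw [h0, det_indicator A1 A2 B hB, map_zero] at h
    exact mul_ne_zero h1 h2 h.symm
  · intro hf
    obtain ⟨m, hm⟩ := MvPolynomial.ne_zero_iff.1 hf
    have key : ∀ p : Fin r → E, (A1.submatrix id p).det ≠ 0 → Function.Injective p := by
      intro p hp i j hij
      by_contra hne
      exact hp (det_zero_of_column_eq hne fun k => by simp [hij])
    have hsupp : ∀ p : Fin r → E, Function.Injective p → ∀ e,
        (∑ i, Finsupp.single (p i) 1 : E →₀ ℕ) e
          = if e ∈ Finset.univ.image p then 1 else 0 := by
      intro p hp e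
      rw [Finsupp.finsetSum_apply]
      simp only [Finsupp.single_apply]
      split_ifs with he
      · obtain ⟨i, -, rfl⟩ := Finset.mem_image.1 he
        simp [hp.eq_iff]
      · refine Finset.sum_eq_zero fun i _ => if_neg ?_
        rintro rfl
        exact he (Finset.mem_image_of_mem _ (Finset.mem_univ _))
    have hm' := hm
    rw [det_expand, MvPolynomial.coeff_sum] at hm'
    obtain ⟨p0, -, hp0⟩ := Finset.exists_ne_zero_of_sum_ne_zero hm'
    rw [MvPolynomial.coeff_monomial] at hp0
    obtain ⟨hmp, hc⟩ := ite_ne_right_iff.1 hp0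
    have hinj := key p0 (left_ne_zero_of_mul hc)
    set B := Finset.univ.image p0 with hBdef
    have hB : B.card = r := by
      rw [hBdef, Finset.card_image_of_injective _ hinj]; simp
    have hev := evalDiag_det A1 A2 (fun j => if j ∈ B then (1 : K) else 0)
    rw [det_indicator A1 A2 B hB] at hev
    have heq : MvPolynomial.eval (fun j => if j ∈ B then (1 : K) else 0)
        (A1.map (MvPolynomial.C (σ := E)) *
          Matrix.diagonal (fun j => (MvPolynomial.X j : MvPolynomial E K)) *
          (A2.map (MvPolynomial.C (σ := E)))ᵀ).det = MvPolynomial.coeff m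
        (A1.map (MvPolynomial.C (σ := E)) *
          Matrix.diagonal (fun j => (MvPolynomial.X j : MvPolynomial E K)) *
          (A2.map (MvPolynomial.C (σ := E)))ᵀ).det := by
      rw [det_expand, MvPolynomial.coeff_sum, map_sum]
      refine Finset.sum_congr rfl fun p _ => ?_
      by_cases hz : (A1.submatrix id p).det = 0
      · simp [hz]
      have hp := key p hz
      generalize (A1.submatrix id p).det * ∏ i, A2 i (p i) = c
      rw [MvPolynomial.coeff_monomial, ← mul_one c, ← MvPolynomial.C_mul_monomial,
        MvPolynomial.monomial_sum_one, map_mul, map_prod, MvPolynomial.eval_C]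
      have hX : ∀ i, MvPolynomial.eval (fun j => if j ∈ B then (1 : K) else 0)
          (MvPolynomial.monomial (Finsupp.single (p i) 1) (1 : K)) = if p i ∈ B then 1 else 0 :=
        fun i => MvPolynomial.eval_X _
      simp only [hX]
      rw [mul_one]
      split_ifs with hpm
      · rw [Finset.prod_eq_one, mul_one]
        intro i _
        rw [if_pos]
        have h1 := hsupp p hp (p i)
        rw [hpm, ← hmp, hsupp p0 hinj] at h1
        by_contra hn
        rw [if_neg hn] at h1
        simp at h1
      · have : ∃ i, p i ∉ B := by
          by_contra! hall
          apply hpm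
          have hsub : Finset.univ.image p = B := by
            apply Finset.eq_of_subset_of_card_le
            · intro e he
              obtain ⟨i, -, rfl⟩ := Finset.mem_image.1 he
              exact hall i
            · rw [hB, Finset.card_image_of_injective _ hp]; simp
          rw [← hmp]
          ext e
          rw [hsupp p hp, hsupp p0 hinj, hsub]
        obtain ⟨i, hi⟩ := this
        rw [Finset.prod_eq_zero (Finset.mem_univ i) (if_neg hi), mul_zero]
    rw [heq] at hev
    rw [hev] at hm
    exact ⟨B, hB, left_ne_zero_of_mul hm, right_ne_zero_of_mul hm⟩
end

section
/- Let (A1, A2) be a Pfaffian pair of constant c over a field K with column set E. Then for every commutative K-algebra R and every vector z = (z_j)_{j∈E} of elements of R, det(A1 · D(z) · A2ᵀ) = c · Σ_{B ∈ B(A1,A2)} ∏_{j∈B} z_j (with A1, A2 regarded as matrices over R via the algebra map). In particular, det(A1 · A2ᵀ) = c · (|B(A1,A2)| : K), where the cardinality of the set of common bases is cast into K (so the number of common bases modulo the characteristic of K equals c⁻¹ · det(A1 · A2ᵀ)). -/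
open Matrix

/-- The set of common bases of the matrix pair `(A1, A2)`. -/
noncomputable def commonBases {K : Type*} [Field K] {r : ℕ} {E : Type*} [Fintype E]
    [LinearOrder E] (A1 A2 : Matrix (Fin r) E K) : Finset (Finset E) := by
  classical
  exact Finset.univ.filter
    (fun B => B.card = r ∧ (colSub A1 B).det ≠ 0 ∧ (colSub A2 B).det ≠ 0)

lemma cb_expand {R : Type*} [CommRing R] {r : ℕ} {E : Type*} [Fintype E] [LinearOrder E]
    (M : Matrix (Fin r) E R) (N : Matrix E (Fin r) R) :
    (M * N).det = ∑ f : Fin r → E, (∏ j, N (f j) j) * (M.submatrix id f).det := by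
  have h1 : (M * N).det = Matrix.detRowAlternating (fun j : Fin r => ∑ e : E, N e j • (fun i => M i e)) := by
    rw [← Matrix.det_transpose]
    change Matrix.detRowAlternating _ = _
    congr 1
    ext j i
    simp [Matrix.mul_apply, mul_comm]
  rw [h1]
  have h2 := (Matrix.detRowAlternating (n := Fin r) (R := R)).toMultilinearMap.map_sum
    (fun (j : Fin r) (e : E) => N e j • (fun i => M i e))
  refine h2.trans (Finset.sum_congr rfl fun f _ => ?_)
  rw [MultilinearMap.map_smul_univ, smul_eq_mul]
  congr 1
  rw [← Matrix.det_transpose]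
  rfl

lemma cb_block {R : Type*} [CommRing R] {r : ℕ} {E : Type*} [Fintype E] [LinearOrder E]
    (M : Matrix (Fin r) E R) (N : Matrix E (Fin r) R) (B : Finset E) :
    ∑ f : Fin r → E with Finset.univ.image f = B, (∏ j, N (f j) j) * (M.submatrix id f).det
      = (colSub M B).det * (colSub Nᵀ B).det * (if B.card = r then 1 else 0) := by
  by_cases h : B.card = r
  · simp only [colSub, h, dif_pos, if_true, mul_one]
    have hN : (Nᵀ.submatrix id (fun i => B.orderEmbOfFin h i)).det
        = ∑ σ : Equiv.Perm (Fin r), (Equiv.Perm.sign σ : R) * ∏ j, N (B.orderEmbOfFin h (σ j)) j := by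
      rw [← Matrix.det_transpose, Matrix.det_apply']
      rfl
    rw [hN, Finset.mul_sum]
    symm
    refine Finset.sum_bij (fun (σ : Equiv.Perm (Fin r)) _ => fun i => B.orderEmbOfFin h (σ i))
      ?_ ?_ ?_ ?_
    · intro σ _
      simp only [Finset.mem_filter, Finset.mem_univ, true_and]
      apply Finset.eq_of_subset_of_card_le
      · intro x hx
        obtain ⟨i, _, rfl⟩ := Finset.mem_image.1 hx
        exact Finset.orderEmbOfFin_mem _ _ _
      · rw [Finset.card_image_of_injective _
          (fun a b hab => σ.injective ((B.orderEmbOfFin h).injective hab))]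
        simp [h]
    · intro σ _ τ _ hst
      refine Equiv.ext fun i => ?_
      have := congrFun hst i
      simpa using this
    · intro f hf
      have hfB : Finset.univ.image f = B := (Finset.mem_filter.1 hf).2
      have hinj : Function.Injective f := by
        have H := (Finset.card_image_iff (s := Finset.univ) (f := f)).1 (by rw [hfB, h]; simp)
        simpa using H
      have hm : ∀ i, f i ∈ B := fun i => hfB ▸ Finset.mem_image_of_mem f (Finset.mem_univ i)
      let g : Fin r → Fin r := fun i => (B.orderIsoOfFin h).symm ⟨f i, hm i⟩
      have hg : Function.Injective g := fun i j hij => by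
        have := (B.orderIsoOfFin h).symm.injective hij
        exact hinj (Subtype.mk.inj this)
      refine ⟨Equiv.ofBijective g (Finite.injective_iff_bijective.1 hg), Finset.mem_univ _, ?_⟩
      funext i
      simp [g, ← Finset.coe_orderIsoOfFin_apply]
    · intro σ _
      have : M.submatrix id (fun i => B.orderEmbOfFin h (σ i))
          = (M.submatrix id (fun i => B.orderEmbOfFin h i)).submatrix id σ := rfl
      rw [this, Matrix.det_permute']
      simp [Units.smul_def]
      ring
  · rw [if_neg h, mul_zero]
    refine Finset.sum_eq_zero fun f hf => ?_
    have hni : ¬ Function.Injective f := fun hi => h (by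
      rw [← (Finset.mem_filter.1 hf).2, Finset.card_image_of_injective _ hi]; simp)
    simp only [Function.Injective, not_forall] at hni
    obtain ⟨a, b, hab, hne⟩ := hni
    rw [Matrix.det_zero_of_column_eq hne (fun k => by simp [hab]), mul_zero]

lemma cb {R : Type*} [CommRing R] {r : ℕ} {E : Type*} [Fintype E] [LinearOrder E]
    (M : Matrix (Fin r) E R) (N : Matrix E (Fin r) R) :
    (M * N).det = ∑ B : Finset E,
      (colSub M B).det * (colSub Nᵀ B).det * (if B.card = r then 1 else 0) := by
  rw [cb_expand, ← Finset.sum_fiberwise Finset.univ (fun f : Fin r → E => Finset.univ.image f)]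
  exact Finset.sum_congr rfl fun B _ => cb_block M N B

lemma main_aux {K : Type*} [Field K] {r : ℕ} {E : Type*} [Fintype E]
    [LinearOrder E] (A1 A2 : Matrix (Fin r) E K) (c : K)
    (hPf : ∀ B ∈ commonBases A1 A2, (colSub A1 B).det * (colSub A2 B).det = c)
    (R : Type*) [CommRing R] [Algebra K R] (z : E → R) :
    (A1.map (algebraMap K R) * Matrix.diagonal z * (A2.map (algebraMap K R))ᵀ).det
        = algebraMap K R c * ∑ B ∈ commonBases A1 A2, ∏ j ∈ B, z j := by
  classical
  rw [cb, Finset.mul_sum]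
  rw [← Finset.sum_subset (Finset.subset_univ (commonBases A1 A2))]
  all_goals
    have key : ∀ B : Finset E, B.card = r →
        (colSub (A1.map (algebraMap K R) * Matrix.diagonal z) B).det *
          (colSub (A2.map (algebraMap K R))ᵀᵀ B).det
        = algebraMap K R ((colSub A1 B).det * (colSub A2 B).det) * ∏ j ∈ B, z j := by
      intro B h
      have e1 : colSub (A1.map (algebraMap K R) * Matrix.diagonal z) B
          = (algebraMap K R).mapMatrix (colSub A1 B)
            * Matrix.diagonal (fun i => z (B.orderEmbOfFin h i)) := by
        ext i j
        simp [colSub, h]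
      have e2 : colSub (A2.map (algebraMap K R))ᵀᵀ B
          = (algebraMap K R).mapMatrix (colSub A2 B) := by
        ext i j
        simp [colSub, h]
      have e3 : ∏ i, z (B.orderEmbOfFin h i) = ∏ j ∈ B, z j := by
        conv_rhs => rw [← Finset.image_orderEmbOfFin_univ B h]
        rw [Finset.prod_image (fun _ _ _ _ h' => (B.orderEmbOfFin h).injective h')]
      rw [e1, e2, Matrix.det_mul, Matrix.det_diagonal, ← RingHom.map_det, ← RingHom.map_det, e3,
        map_mul]
      ring
  · refine Finset.sum_congr rfl fun B hB => ?_
    have h : B.card = r := by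
      simp only [commonBases, Finset.mem_filter] at hB
      exact hB.2.1
    rw [key B h, hPf B hB, if_pos h, mul_one]
  · intro B _ hB
    by_cases h : B.card = r
    · rw [key B h]
      have : (colSub A1 B).det * (colSub A2 B).det = 0 := by
        by_contra hne
        apply hB
        simp only [commonBases, Finset.mem_filter, Finset.mem_univ, true_and]
        exact ⟨h, left_ne_zero_of_mul hne, right_ne_zero_of_mul hne⟩
      simp [this]
    · simp [h]

/-- For a Pfaffian pair `(A1, A2)` of constant `c`, for every commutative `K`-algebra `R` and
every vector `z` over `R` one has
`det (A1 * D(z) * A2ᵀ) = c * ∑_{B ∈ B(A1,A2)} ∏_{j ∈ B} z_j`; in particular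
`det (A1 * A2ᵀ) = c * |B(A1,A2)|` in `K`. -/
theorem pfaffian_pair_counting {K : Type*} [Field K] {r : ℕ} {E : Type*} [Fintype E]
    [LinearOrder E] (A1 A2 : Matrix (Fin r) E K) (c : K) (hc : c ≠ 0)
    (hPf : ∀ B ∈ commonBases A1 A2, (colSub A1 B).det * (colSub A2 B).det = c)
    (R : Type*) [CommRing R] [Algebra K R] (z : E → R) :
    (A1.map (algebraMap K R) * Matrix.diagonal z * (A2.map (algebraMap K R))ᵀ).det
        = algebraMap K R c * ∑ B ∈ commonBases A1 A2, ∏ j ∈ B, z j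
    ∧ (A1 * A2ᵀ).det = c * ((commonBases A1 A2).card : K) := by
  refine ⟨main_aux A1 A2 c hPf R z, ?_⟩
  have h := main_aux A1 A2 c hPf K (fun _ => 1)
  simpa using h
end

section
/- Let (A, L) be a matroid parity over a field K and let R be a commutative K-algebra. Then for every vector z = (z_l)_{l∈L} of elements of R, det(A · Δ_L(z) · Aᵀ) = ( Σ_{B ∈ B(A,L)} det A[B] · ∏_{l∈B} z_l )², with A regarded as a matrix over R via the algebra map. (This is the square of the Pfaffian expansion pf(A Δ_L(z) Aᵀ) = Σ_{B ∈ B(A,L)} det A[B] ∏_{l∈B} z_l.) -/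
open Matrix

/-- The `2r × 2|B|` submatrix of `A` formed by both columns of each line in `B`, lines taken
in increasing order (junk value `0` if `B.card ≠ r`). -/
noncomputable def paritySub {K : Type*} [CommRing K] {r : ℕ} {L : Type*} [Fintype L]
    [LinearOrder L] (A : Matrix (Fin r × Fin 2) (L × Fin 2) K) (B : Finset L) :
    Matrix (Fin r × Fin 2) (Fin r × Fin 2) K :=
  if h : B.card = r then A.submatrix id (fun p => (B.orderEmbOfFin h p.1, p.2)) else 0

/-- The block-diagonal skew-symmetric matrix `Δ_L(z)` whose `2 × 2` diagonal block for line `l`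
is `[[0, z l], [-z l, 0]]`. -/
def deltaMat {R : Type*} [CommRing R] {L : Type*} [DecidableEq L] (z : L → R) :
    Matrix (L × Fin 2) (L × Fin 2) R :=
  Matrix.of fun p q =>
    if p.1 = q.1 then
      if p.2 = 0 ∧ q.2 = 1 then z p.1
      else if p.2 = 1 ∧ q.2 = 0 then - z p.1
      else 0
    else 0

/-- The set of parity bases of the matroid parity `(A, L)`. -/
noncomputable def parityBases {K : Type*} [Field K] {r : ℕ} {L : Type*} [Fintype L]
    [LinearOrder L] (A : Matrix (Fin r × Fin 2) (L × Fin 2) K) : Finset (Finset L) := by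
  classical
  exact Finset.univ.filter (fun B => B.card = r ∧ (paritySub A B).det ≠ 0)

section parityAux

open Matrix Finset

/-- sum over all assignments -/
noncomputable def pAuxN {K : Type*} [CommRing K] {r : ℕ} {L : Type*} [Fintype L]
    (A : Matrix (Fin r × Fin 2) (L × Fin 2) K) (z : L → K) : K :=
  ∑ f : Fin r → L, (A.submatrix id (fun p : Fin r × Fin 2 => (f p.1, p.2))).det * ∏ i, z (f i)

/-- unnormalised Pfaffian -/
noncomputable def pAuxPF {K : Type*} [CommRing K] {r : ℕ}
    (M : Matrix (Fin r × Fin 2) (Fin r × Fin 2) K) : K :=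
  ∑ σ : Equiv.Perm (Fin r × Fin 2), ((Equiv.Perm.sign σ : ℤ) : K) * ∏ i, M (σ (i, 0)) (σ (i, 1))

noncomputable def pAuxQ {K : Type*} [CommRing K] {r : ℕ} {L : Type*} [Fintype L] [LinearOrder L]
    (A : Matrix (Fin r × Fin 2) (L × Fin 2) K) (z : L → K) : K :=
  ∑ B ∈ powersetCard r (univ : Finset L), (paritySub A B).det * ∏ l ∈ B, z l

theorem pAux_W {K : Type*} [CommRing K] {r : ℕ} {L : Type*} [Fintype L]
    (A : Matrix (Fin r × Fin 2) (L × Fin 2) K) (z : L → K) :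
    pAuxN A z = pAuxPF (Matrix.of fun p q => ∑ l, z l * (A p (l, 0) * A q (l, 1))) := by
  classical
  unfold pAuxN pAuxPF
  simp only [det_apply', Matrix.of_apply, Finset.prod_univ_sum, Finset.sum_mul, Finset.mul_sum]
  rw [Finset.sum_comm]
  refine Finset.sum_congr rfl fun σ _ => ?_
  rw [Fintype.piFinset_univ]
  refine Finset.sum_congr rfl fun f _ => ?_
  simp only [submatrix_apply, id, Fintype.prod_prod_type, Fin.prod_univ_two, Finset.prod_mul_distrib]
  ring

theorem pAux_PF {K : Type*} [CommRing K] {r : ℕ}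
    (W : Matrix (Fin r × Fin 2) (Fin r × Fin 2) K) :
    pAuxPF (W - Wᵀ) = 2 ^ r * pAuxPF W := by
  classical
  unfold pAuxPF
  simp only [Matrix.sub_apply, Matrix.transpose_apply, sub_eq_add_neg, Finset.prod_add,
    Finset.mul_sum]
  rw [Finset.sum_comm]
  have key : ∀ T ∈ (univ : Finset (Fin r)).powerset,
      ∑ σ : Equiv.Perm (Fin r × Fin 2), ((Equiv.Perm.sign σ : ℤ) : K) *
        ((∏ i ∈ T, W (σ (i, 0)) (σ (i, 1))) * ∏ i ∈ univ \ T, -W (σ (i, 1)) (σ (i, 0)))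
      = ∑ σ : Equiv.Perm (Fin r × Fin 2), ((Equiv.Perm.sign σ : ℤ) : K) *
          ∏ i, W (σ (i, 0)) (σ (i, 1)) := by
    intro T _
    set τ : Equiv.Perm (Fin r × Fin 2) :=
      Equiv.prodCongrRight (fun i => if i ∈ T then 1 else Equiv.swap 0 1) with hτ
    rw [← Equiv.sum_comp (Equiv.mulRight τ)]
    refine Finset.sum_congr rfl fun σ _ => ?_
    have hs : Equiv.Perm.sign τ = ∏ i ∈ univ \ T, (-1 : ℤˣ) := by
      rw [hτ, Equiv.Perm.sign_prodCongrRight, ← Finset.prod_sdiff (Finset.subset_univ T), mul_comm,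
        Finset.prod_eq_one, one_mul]
      · refine Finset.prod_congr rfl fun i hi => ?_
        rw [if_neg (by simpa using hi)]
        simp [Equiv.Perm.sign_swap]
      · intro i hi
        simp [hi]
    have h1 : ∏ i ∈ T, W ((σ * τ) (i, 0)) ((σ * τ) (i, 1)) = ∏ i ∈ T, W (σ (i, 0)) (σ (i, 1)) := by
      refine Finset.prod_congr rfl fun i hi => ?_
      simp [hτ, hi]
    have h2 : ∏ i ∈ univ \ T, -W ((σ * τ) (i, 1)) ((σ * τ) (i, 0))
        = (∏ i ∈ univ \ T, (-1 : K)) * ∏ i ∈ univ \ T, W (σ (i, 0)) (σ (i, 1)) := by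
      rw [← Finset.prod_mul_distrib]
      refine Finset.prod_congr rfl fun i hi => ?_
      have : i ∉ T := by simpa using hi
      simp [hτ, this]
    simp only [Equiv.coe_mulRight]
    rw [h1, h2, ← Finset.prod_sdiff (Finset.subset_univ T), Equiv.Perm.sign_mul, hs]
    simp only [Finset.prod_const]
    push_cast
    have : ((-1 : K) ^ #(univ \ T)) * ((-1 : K) ^ #(univ \ T)) = 1 := by
      rw [← mul_pow]; simp
    linear_combination (((Equiv.Perm.sign σ : ℤ) : K) * (∏ i ∈ T, W (σ (i, 0)) (σ (i, 1))) *
      ∏ i ∈ univ \ T, W (σ (i, 0)) (σ (i, 1))) * this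
  rw [Finset.sum_congr rfl key]
  simp [Finset.mul_sum]

theorem pAux_det_perm {K : Type*} [CommRing K] {r : ℕ} {L : Type*}
    (A : Matrix (Fin r × Fin 2) (L × Fin 2) K) (f : Fin r → L) (π : Equiv.Perm (Fin r)) :
    (A.submatrix id (fun p : Fin r × Fin 2 => (f (π p.1), p.2))).det =
    (A.submatrix id (fun p : Fin r × Fin 2 => (f p.1, p.2))).det := by
  classical
  have := Matrix.det_permute' (Equiv.prodCongrLeft (fun _ : Fin 2 => π))
    (A.submatrix id (fun p : Fin r × Fin 2 => (f p.1, p.2)))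
  rw [Equiv.Perm.sign_prodCongrLeft] at this
  simp only [Fin.prod_univ_two, Int.units_mul_self] at this
  simp only [Units.val_one, Int.cast_one, one_mul] at this
  exact this

theorem pAux_NQ {K : Type*} [CommRing K] {r : ℕ} {L : Type*} [Fintype L] [LinearOrder L]
    (A : Matrix (Fin r × Fin 2) (L × Fin 2) K) (z : L → K) :
    pAuxN A z = (r.factorial : K) * pAuxQ A z := by
  classical
  unfold pAuxN pAuxQ
  rw [← Finset.sum_filter_add_sum_filter_not univ (fun f : Fin r → L => Function.Injective f)]
  have h0 : ∑ f : Fin r → L with ¬ Function.Injective f,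
      (A.submatrix id (fun p : Fin r × Fin 2 => (f p.1, p.2))).det * ∏ i, z (f i) = 0 := by
    refine Finset.sum_eq_zero fun f hf => ?_
    have hf : ¬ Function.Injective f := by simpa using hf
    simp only [Function.Injective, not_forall] at hf
    obtain ⟨a, b, hab, hne⟩ := hf
    rw [Matrix.det_zero_of_column_eq (i := (a, 0)) (j := (b, 0)), zero_mul]
    · simpa using hne
    · intro k; simp [hab]
  rw [h0, add_zero, ← Finset.sum_fiberwise_of_maps_to (g := fun f : Fin r → L => univ.image f)
    (t := powersetCard r univ), Finset.mul_sum]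
  swap
  · intro f hf
    have hf : Function.Injective f := by simpa using hf
    simp [Finset.mem_powersetCard, Finset.card_image_of_injective _ hf]
  refine Finset.sum_congr rfl fun B hB => ?_
  have hB : #B = r := by simpa [Finset.mem_powersetCard] using hB
  have hbij : ∑ π : Equiv.Perm (Fin r), (paritySub A B).det * ∏ l ∈ B, z l = 
     ∑ f ∈ filter (fun f : Fin r → L => univ.image f = B)
       (filter (fun f : Fin r → L => Function.Injective f) univ),
      (A.submatrix id (fun p : Fin r × Fin 2 => (f p.1, p.2))).det * ∏ i, z (f i) := by
    refine Finset.sum_bij (fun π _ => fun i => B.orderEmbOfFin hB (π i)) ?_ ?_ ?_ ?_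
    · intro π _
      simp only [mem_filter, mem_univ, true_and]
      refine ⟨(B.orderEmbOfFin hB).injective.comp π.injective, ?_⟩
      apply Finset.coe_injective
      rw [Finset.coe_image, Finset.coe_univ, Set.image_univ]
      exact (π.surjective.range_comp (B.orderEmbOfFin hB)).trans (Finset.range_orderEmbOfFin B hB)
    · intro π _ π' _ h
      refine Equiv.ext fun i => ?_
      have := congrFun h i
      simpa using this
    · intro f hf
      simp only [mem_filter, mem_univ, true_and] at hf
      obtain ⟨hi, him⟩ := hf
      have hm : ∀ i, f i ∈ B := fun i => him ▸ Finset.mem_image_of_mem f (mem_univ i)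
      let g : Fin r → Fin r := fun i => (B.orderIsoOfFin hB).symm ⟨f i, hm i⟩
      have hg : Function.Injective g := by
        intro a b hab
        have := (B.orderIsoOfFin hB).symm.injective hab
        exact hi (congrArg Subtype.val this)
      refine ⟨Equiv.ofBijective g (Finite.injective_iff_bijective.mp hg), mem_univ _, ?_⟩
      funext i
      simp [g, ← Finset.coe_orderIsoOfFin_apply]
    · intro π _
      rw [pAux_det_perm A (B.orderEmbOfFin hB) π, paritySub, dif_pos hB]
      congr 1
      rw [Equiv.prod_comp π (fun i => z (B.orderEmbOfFin hB i))]
      have hp := Finset.prod_map univ (B.orderEmbOfFin hB).toEmbedding z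
      rw [Finset.map_orderEmbOfFin_univ] at hp
      exact hp
  rw [← hbij]
  simp [Fintype.card_perm]

theorem pAux_delta {K : Type*} [CommRing K] {r : ℕ} {L : Type*} [Fintype L] [DecidableEq L]
    (A : Matrix (Fin r × Fin 2) (L × Fin 2) K) (z : L → K) (p q : Fin r × Fin 2) :
    (A * deltaMat z * Aᵀ) p q =
      ∑ l, z l * (A p (l, 0) * A q (l, 1)) - ∑ l, z l * (A q (l, 0) * A p (l, 1)) := by
  have h0 : ∀ l, (A * deltaMat z) p (l, 0) = - (A p (l, 1) * z l) := by
    intro l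
    simp [Matrix.mul_apply, Fintype.sum_prod_type, deltaMat, Finset.sum_add_distrib]
  have h1 : ∀ l, (A * deltaMat z) p (l, 1) = A p (l, 0) * z l := by
    intro l
    simp [Matrix.mul_apply, Fintype.sum_prod_type, deltaMat, Finset.sum_add_distrib]
  rw [Matrix.mul_apply]
  simp only [Fintype.sum_prod_type, Fin.sum_univ_two, h0, h1, transpose_apply]
  rw [← Finset.sum_sub_distrib]
  exact Finset.sum_congr rfl fun l _ => by ring

theorem pAux_PFQ {K : Type*} [CommRing K] {r : ℕ} {L : Type*} [Fintype L] [LinearOrder L]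
    (A : Matrix (Fin r × Fin 2) (L × Fin 2) K) (z : L → K) :
    pAuxPF (A * deltaMat z * Aᵀ) = 2 ^ r * ((r.factorial : K) * pAuxQ A z) := by
  rw [← pAux_NQ, pAux_W, ← pAux_PF]
  congr 1
  ext p q
  rw [pAux_delta]
  simp

/-- normal form of alternating matrices -/
theorem pAux_normal {K : Type*} [Field K] {ι : Type*} [DecidableEq ι] (k : ℕ) :
    ∀ (S : Finset ι) (M : ι → ι → K), #S ≤ 2 * k → (∀ p, M p p = 0) → (∀ p q, M p q = - M q p) →
      (∀ p, p ∉ S → ∀ q, M p q = 0) →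
      ∃ a b : Fin k → ι → K, ∀ p q, M p q = ∑ t, (a t p * b t q - a t q * b t p) := by
  induction k with
  | zero =>
    intro S M hS _ _ h
    have : S = ∅ := by simpa using hS
    subst this
    exact ⟨fun _ _ => 0, fun _ _ => 0, fun p q => by simp [h p]⟩
  | succ k ih =>
    intro S M hS hd ha h
    by_cases h0 : ∀ p q, M p q = 0
    · exact ⟨fun _ _ => 0, fun _ _ => 0, fun p q => by simp [h0]⟩
    push Not at h0
    obtain ⟨i, j, hc⟩ := h0
    have hij : i ≠ j := by rintro rfl; exact hc (hd i)
    have hiS : i ∈ S := by by_contra hn; exact hc (h i hn j)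
    have hjS : j ∈ S := by
      by_contra hn; exact hc (by rw [ha, h j hn i, neg_zero])
    obtain ⟨a, b, hab⟩ := ih ((S.erase i).erase j)
      (fun p q => M p q - (M i j)⁻¹ * (M p i * M q j - M q i * M p j)) (by
        rw [Finset.card_erase_of_mem (by simp [hjS, hij.symm]), Finset.card_erase_of_mem hiS]
        omega) (by intro p; simp only [hd p]; ring)
        (by intro p q; rw [ha p q]; ring) (by
        intro p hp q
        simp only [mem_erase, not_and_or, not_not] at hp
        rcases hp with rfl | rfl | hp
        · simp only [hd, ha p i, ha q p]
          field_simp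
          ring
        · simp only [hd, ha q p]
          field_simp
          ring
        · simp [h p hp])
    refine ⟨Fin.cons (fun p => (M i j)⁻¹ * M p i) a, Fin.cons (fun p => M p j) b, fun p q => ?_⟩
    rw [Fin.sum_univ_succ]
    simp only [Fin.cons_zero, Fin.cons_succ, ← hab]
    ring

theorem pAux_field {K : Type*} [Field K] [CharZero K] {r : ℕ} {L : Type*} [Fintype L]
    [LinearOrder L] (A : Matrix (Fin r × Fin 2) (L × Fin 2) K) (z : L → K) :
    (A * deltaMat z * Aᵀ).det = pAuxQ A z ^ 2 := by
  obtain ⟨a, b, hab⟩ := pAux_normal r (univ : Finset (Fin r × Fin 2)) (A * deltaMat z * Aᵀ)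
    (by simp [mul_comm]) (by intro p; rw [pAux_delta]; ring)
    (by intro p q; rw [pAux_delta, pAux_delta]; ring) (by intro p hp; simp at hp)
  let P : Matrix (Fin r × Fin 2) (Fin r × Fin 2) K :=
    Matrix.of fun p q => if q.2 = 0 then a q.1 p else b q.1 p
  have hP : A * deltaMat z * Aᵀ = P * deltaMat (fun _ => 1) * Pᵀ := by
    ext p q
    rw [pAux_delta P, hab]
    simp [P]
  have hQ : pAuxQ P (fun _ => 1) = P.det := by
    have : powersetCard r (univ : Finset (Fin r)) = {univ} := by
      have h := Finset.powersetCard_self (univ : Finset (Fin r))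
      rwa [Finset.card_fin] at h
    have he : ∀ i, (univ : Finset (Fin r)).orderEmbOfFin (Finset.card_fin r) i = i := by
      intro i
      have := Finset.orderEmbOfFin_unique (Finset.card_fin r) (f := id) (by simp) strictMono_id
      exact (congrFun this i).symm
    unfold pAuxQ
    rw [this]
    simp [paritySub, he]
    rfl
  have hD : (deltaMat (fun _ : Fin r => (1 : K))).det = 1 := by
    have : deltaMat (fun _ : Fin r => (1 : K)) =
        (Matrix.blockDiagonal fun _ : Fin r => !![(0 : K), 1; -1, 0]).submatrix
          (Equiv.prodComm _ _) (Equiv.prodComm _ _) := by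
      ext ⟨i, e⟩ ⟨j, e'⟩
      fin_cases e <;> fin_cases e' <;> simp [deltaMat, Matrix.blockDiagonal_apply]
    rw [this, Matrix.det_submatrix_equiv_self, Matrix.det_blockDiagonal]
    simp [Matrix.det_fin_two]
  have hE := pAux_PFQ A z
  rw [hP, pAux_PFQ, hQ] at hE
  have h2 : (2 : K) ^ r ≠ 0 := pow_ne_zero _ two_ne_zero
  have hf : (r.factorial : K) ≠ 0 := Nat.cast_ne_zero.mpr (Nat.factorial_ne_zero r)
  have := mul_left_cancel₀ hf (mul_left_cancel₀ h2 hE)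
  rw [hP, det_mul, det_mul, det_transpose, hD, ← this]
  ring

theorem pAux_sub_map {K R : Type*} [CommRing K] [CommRing R] (φ : K →+* R) {r : ℕ} {L : Type*}
    [Fintype L] [LinearOrder L] (A : Matrix (Fin r × Fin 2) (L × Fin 2) K) (B : Finset L) :
    (paritySub (A.map φ) B).det = φ (paritySub A B).det := by
  rw [RingHom.map_det]
  congr 1
  unfold paritySub
  split_ifs
  · rfl
  · ext; simp

theorem pAux_Q_map {K R : Type*} [CommRing K] [CommRing R] (φ : K →+* R) {r : ℕ} {L : Type*}
    [Fintype L] [LinearOrder L] (A : Matrix (Fin r × Fin 2) (L × Fin 2) K) (z : L → K) :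
    pAuxQ (A.map φ) (fun l => φ (z l)) = φ (pAuxQ A z) := by
  simp [pAuxQ, pAux_sub_map]

theorem pAux_D_map {K R : Type*} [CommRing K] [CommRing R] (φ : K →+* R) {r : ℕ} {L : Type*}
    [Fintype L] [LinearOrder L] (A : Matrix (Fin r × Fin 2) (L × Fin 2) K) (z : L → K) :
    (A.map φ * deltaMat (fun l => φ (z l)) * (A.map φ)ᵀ).det
      = φ (A * deltaMat z * Aᵀ).det := by
  rw [RingHom.map_det]
  congr 1
  ext p q
  rw [RingHom.mapMatrix_apply, Matrix.map_apply, pAux_delta, pAux_delta]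
  simp

theorem pAux_ring {R : Type*} [CommRing R] {r : ℕ} {L : Type*} [Fintype L]
    [LinearOrder L] (A : Matrix (Fin r × Fin 2) (L × Fin 2) R) (z : L → R) :
    (A * deltaMat z * Aᵀ).det = pAuxQ A z ^ 2 := by
  let I := ((Fin r × Fin 2) × (L × Fin 2)) ⊕ L
  let U := MvPolynomial I ℤ
  let X : Matrix (Fin r × Fin 2) (L × Fin 2) U := Matrix.of fun p q => MvPolynomial.X (Sum.inl (p, q))
  let y : L → U := fun l => MvPolynomial.X (Sum.inr l)
  let F := FractionRing U
  have hinj : Function.Injective (algebraMap U F) := IsFractionRing.injective U F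
  haveI : CharZero F := charZero_of_injective_algebraMap hinj
  have hU : (X * deltaMat y * Xᵀ).det = pAuxQ X y ^ 2 := by
    apply hinj
    rw [← pAux_D_map, map_pow, ← pAux_Q_map]
    exact pAux_field _ _
  let φ : U →+* R := MvPolynomial.eval₂Hom (Int.castRingHom R)
    (Sum.elim (fun pq => A pq.1 pq.2) z)
  have hA : X.map φ = A := by ext p q; exact (MvPolynomial.eval₂Hom_X' _ _ _)
  have hz : (fun l => φ (y l)) = z := by ext l; exact (MvPolynomial.eval₂Hom_X' _ _ _)
  have := congrArg φ hU
  rw [← pAux_D_map, map_pow, ← pAux_Q_map, hA, hz] at this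
  exact this

end parityAux

/-- For a matroid parity `(A, L)` over a field `K` and a commutative `K`-algebra `R`, for every
vector `z = (z_l)_{l ∈ L}` over `R`,
`det (A * Δ_L(z) * Aᵀ) = (∑_{B ∈ B(A,L)} det A[B] * ∏_{l ∈ B} z_l)²`
(the square of the Pfaffian expansion `pf (A Δ_L(z) Aᵀ)`). -/
theorem parity_det_eq_sq {K : Type*} [Field K] {r : ℕ} {L : Type*} [Fintype L] [LinearOrder L]
    (A : Matrix (Fin r × Fin 2) (L × Fin 2) K)
    (R : Type*) [CommRing R] [Algebra K R] (z : L → R) :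
    (A.map (algebraMap K R) * deltaMat z * (A.map (algebraMap K R))ᵀ).det
      = (∑ B ∈ parityBases A,
          algebraMap K R (paritySub A B).det * ∏ l ∈ B, z l) ^ 2 := by
  rw [pAux_ring]
  congr 1
  classical
  unfold pAuxQ parityBases
  symm
  refine Finset.sum_subset_zero_on_sdiff ?_ ?_ ?_
  · intro B hB
    simp only [Finset.mem_filter, Finset.mem_univ, true_and] at hB
    simp [Finset.mem_powersetCard, hB.1]
  · intro B hB
    simp only [Finset.mem_sdiff, Finset.mem_powersetCard, Finset.subset_univ, true_and,
      Finset.mem_filter, Finset.mem_univ, not_and, not_not] at hB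
    rw [pAux_sub_map, hB.2 hB.1, map_zero, zero_mul]
  · intro B _
    rw [pAux_sub_map]
end

section
/- Let (A, L) be a matroid parity over a field K and let (X_l)_{l∈L} be distinct indeterminates. Then (A, L) has a parity base if and only if the determinant of the matrix A · Δ_L(X) · Aᵀ, regarded as a matrix over the multivariate polynomial ring K[X_l : l ∈ L], is nonzero. -/
open Matrix

def AltM {n R : Type*} [CommRing R] (M : Matrix n n R) : Prop :=
  (∀ i j, M i j = - M j i) ∧ ∀ i, M i i = 0

lemma AltM.conj {n m R : Type*} [CommRing R] [Fintype n] {N : Matrix n n R}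
    (h : AltM N) (U : Matrix m n R) : AltM (U * N * Uᵀ) := by
  have e : ∀ i j, (U * N * Uᵀ) i j = ∑ p : n × n, U i p.1 * N p.1 p.2 * U j p.2 := by
    intro i j
    rw [Fintype.sum_prod_type_right]
    simp [Matrix.mul_apply, Finset.sum_mul]
  constructor
  · intro i j
    rw [e, e, ← Finset.sum_neg_distrib, ← Equiv.sum_comp (Equiv.prodComm n n)]
    refine Finset.sum_congr rfl fun p _ => ?_
    simp only [Equiv.prodComm_apply, Prod.fst_swap, Prod.snd_swap]
    rw [h.1 p.2 p.1]; ring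
  · intro i
    classical
    rw [e]
    refine Finset.sum_involution (fun p _ => p.swap) ?_ ?_ ?_ ?_
    · intro p _
      simp only [Prod.fst_swap, Prod.snd_swap]
      rw [h.1 p.2 p.1]; ring
    · rintro ⟨a, b⟩ _ hne hs
      simp only [Prod.swap_prod_mk, Prod.mk.injEq] at hs
      obtain ⟨rfl, -⟩ := hs
      simp [h.2] at hne
    · simp
    · simp

lemma AltM.add {n R : Type*} [CommRing R] {M N : Matrix n n R}
    (h : AltM M) (h' : AltM N) : AltM (M + N) :=
  ⟨fun i j => by simp only [Matrix.add_apply]; rw [h.1, h'.1]; ring,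
    fun i => by simp [h.2, h'.2]⟩

lemma AltM.smul {n R : Type*} [CommRing R] {M : Matrix n n R}
    (h : AltM M) (c : R) : AltM (c • M) :=
  ⟨fun i j => by simp only [Matrix.smul_apply, smul_eq_mul]; rw [h.1]; ring,
    fun i => by simp [h.2]⟩

lemma AltM.neg {n R : Type*} [CommRing R] {M : Matrix n n R}
    (h : AltM M) : AltM (-M) :=
  ⟨fun i j => by simp only [Matrix.neg_apply]; rw [h.1], fun i => by simp [h.2]⟩

lemma altM_delta {L R : Type*} [CommRing R] [DecidableEq L] (z : L → R) :
    AltM (deltaMat z) := by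
  constructor
  · rintro ⟨l, a⟩ ⟨k, b⟩
    by_cases h : l = k
    · subst h
      fin_cases a <;> fin_cases b <;> simp [deltaMat]
    · simp [deltaMat, h, Ne.symm h]
  · rintro ⟨l, a⟩
    fin_cases a <;> simp [deltaMat]

lemma AltM.inv {n F : Type*} [Field F] [Fintype n] [DecidableEq n] {N : Matrix n n F}
    (h : AltM N) (hN : N.det ≠ 0) : AltM N⁻¹ := by
  have ht : Nᵀ = -N := by ext i j; simpa using h.1 j i
  have e : N⁻¹ = -(N⁻¹ * N * (N⁻¹)ᵀ) := by
    have hu : IsUnit N.det := isUnit_iff_ne_zero.2 hN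
    have h2 : (-N) * (N⁻¹)ᵀ = 1 := by
      rw [← ht, ← Matrix.transpose_mul, Matrix.nonsing_inv_mul _ hu, Matrix.transpose_one]
    have h3 : N * (N⁻¹)ᵀ = -1 := by
      rw [← h2]; simp
    rw [Matrix.mul_assoc, h3]; simp
  rw [e]
  exact (h.conj _).neg

lemma det_update {n F : Type*} [Field F] [Fintype n] [DecidableEq n] {N : Matrix n n F}
    (h : AltM N) (hN : N.det ≠ 0) (U : Matrix n (Fin 2) F) (z : F) :
    ∃ c, (N + U * (!![0, z; -z, 0] * Uᵀ)).det = N.det * (c * c) := by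
  have hu : IsUnit N.det := isUnit_iff_ne_zero.2 hN
  have ha := (h.inv hN).conj Uᵀ
  rw [Matrix.transpose_transpose] at ha
  rw [Matrix.det_add_mul _ _ hu]
  have e : !![0, z; -z, 0] * Uᵀ * N⁻¹ * U = !![0, z; -z, 0] * (Uᵀ * N⁻¹ * U) := by
    simp only [Matrix.mul_assoc]
  rw [e]
  generalize Uᵀ * N⁻¹ * U = Q at ha
  refine ⟨1 + z * Q 1 0, ?_⟩
  congr 1
  rw [Matrix.det_fin_two]
  simp [Matrix.vecMul, dotProduct, Fin.sum_univ_two, ha.2]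
  left
  rw [ha.1 0 1]; ring

lemma entry {n L R : Type*} [CommRing R] [Fintype L] [DecidableEq L]
    (A : Matrix n (L × Fin 2) R) (z : L → R) (i j : n) :
    (A * deltaMat z * Aᵀ) i j =
      ∑ l, z l * (A i (l, 0) * A j (l, 1) - A i (l, 1) * A j (l, 0)) := by
  simp only [Matrix.mul_apply, Fintype.sum_prod_type, Fin.sum_univ_two, deltaMat, Matrix.of_apply,
    Matrix.transpose_apply]
  refine Finset.sum_congr rfl fun l _ => ?_
  simp
  ring

lemma square_field {n L F : Type*} [Field F] [Fintype n] [DecidableEq n] [Fintype L]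
    [DecidableEq L] (A : Matrix n (L × Fin 2) F) (z : L → F) (N : Matrix n n F) (h : AltM N)
    (hd : ∀ S : Finset L, (N + A * deltaMat (fun l => if l ∈ S then z l else 0) * Aᵀ).det ≠ 0)
    (hs : IsSquare N.det) (S : Finset L) :
    IsSquare (N + A * deltaMat (fun l => if l ∈ S then z l else 0) * Aᵀ).det := by
  induction S using Finset.induction_on with
  | empty =>
    have : deltaMat (fun l : L => if l ∈ (∅ : Finset L) then z l else 0) = 0 := by
      ext p q; simp [deltaMat]
    rw [this]; simpa using hs
  | insert k S hk ih =>
    obtain ⟨c, hc⟩ := det_update (h.add ((altM_delta _).conj A)) (hd S)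
      (Matrix.of fun i a => A i (k, a)) (z k)
    have e : N + A * deltaMat (fun l => if l ∈ insert k S then z l else 0) * Aᵀ =
      N + A * deltaMat (fun l => if l ∈ S then z l else 0) * Aᵀ +
       (Matrix.of fun i a => A i (k, a)) * (!![0, z k; -z k, 0] *
        (Matrix.of fun i a => A i (k, a))ᵀ) := by
      ext i j
      simp only [Matrix.add_apply, entry]
      rw [add_assoc]
      congr 1
      have : ∀ l, (if l ∈ insert k S then z l else 0) =
        (if l ∈ S then z l else 0) + if l = k then z l else 0 := by
        intro l
        by_cases hl : l = k
        · subst hl; simp [hk]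
        · simp [hl]
      simp only [this, add_mul, Finset.sum_add_distrib]
      congr 1
      simp [Matrix.mul_apply, Matrix.vecMul, dotProduct, Fin.sum_univ_two]
      ring
    rw [e, hc]
    exact ih.mul ⟨c, rfl⟩

lemma delta_det {m R : Type*} [CommRing R] [Fintype m] [DecidableEq m] :
    (deltaMat (fun _ : m => (1 : R))).det = 1 := by
  have : deltaMat (fun _ : m => (1 : R)) =
     (Matrix.blockDiagonal fun _ : m => (!![0, 1; -1, 0] : Matrix (Fin 2) (Fin 2) R)).submatrix
      (Equiv.prodComm m (Fin 2)) (Equiv.prodComm m (Fin 2)) := by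
    ext ⟨l, a⟩ ⟨k, b⟩
    by_cases h : l = k
    · subst h
      fin_cases a <;> fin_cases b <;> simp [deltaMat, Matrix.blockDiagonal_apply]
    · simp [deltaMat, Matrix.blockDiagonal_apply, h]
  rw [this, Matrix.det_submatrix_equiv_self, Matrix.det_blockDiagonal]
  simp [Matrix.det_fin_two]

lemma map_delta {m R T : Type*} [CommRing R] [CommRing T] [DecidableEq m] (f : R →+* T)
    (z : m → R) : (deltaMat z).map f = deltaMat (fun l => f (z l)) := by
  ext p q
  simp only [deltaMat, Matrix.map_apply, Matrix.of_apply]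
  split_ifs <;> simp

lemma square_ufd {m L R : Type*} [CommRing R] [IsDomain R] [UniqueFactorizationMonoid R]
    [Fintype m] [DecidableEq m] [Fintype L]
    [DecidableEq L] (A : Matrix (m × Fin 2) (L × Fin 2) R) (z : L → R) :
    IsSquare (A * deltaMat z * Aᵀ).det := by
  let P := Polynomial R
  let F := FractionRing P
  let ι : P →+* F := algebraMap P F
  have hι : Function.Injective ι := IsFractionRing.injective P F
  let φ : R →+* F := ι.comp Polynomial.C
  let J := deltaMat (fun _ : m => (1 : R))
  have hmap : ∀ w : L → R, ι (((Polynomial.X : P) • J.map Polynomial.C +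
      (A * deltaMat w * Aᵀ).map Polynomial.C).det) =
      ((ι Polynomial.X) • deltaMat (fun _ : m => (1 : F)) +
        A.map φ * deltaMat (fun l => φ (w l)) * (A.map φ)ᵀ).det := by
    intro w
    rw [RingHom.map_det]
    congr 1
    have : A.map φ * deltaMat (fun l => φ (w l)) * (A.map φ)ᵀ = (A * deltaMat w * Aᵀ).map φ := by
      rw [Matrix.map_mul, Matrix.map_mul, map_delta, Matrix.transpose_map]
    rw [this]
    have h1 : deltaMat (fun _ : m => (1 : F)) = J.map φ := by
      rw [map_delta]; simp
    rw [h1]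
    generalize A * deltaMat w * Aᵀ = Q
    ext i j
    simp [φ]
    ring
  have hne : ∀ B : Matrix (m × Fin 2) (m × Fin 2) R, ((Polynomial.X : P) • J.map Polynomial.C +
      B.map Polynomial.C).det ≠ 0 := by
    intro B h0
    have := Polynomial.coeff_det_X_add_C_card J B
    rw [h0] at this
    rw [delta_det] at this
    simp at this
  have key := square_field (A.map φ) (fun l => φ (z l))
    ((ι Polynomial.X) • deltaMat (fun _ : m => (1 : F))) ((altM_delta _).smul _) (by
      intro S
      have := hmap (fun l => if l ∈ S then z l else 0)
      simp only [apply_ite φ, map_zero] at this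
      rw [← this]
      exact (map_ne_zero_iff ι hι).2 (hne _)) (by
      rw [Matrix.det_smul]
      rw [delta_det, mul_one, Fintype.card_prod, Fintype.card_fin, pow_mul]
      exact ⟨_, sq _⟩) Finset.univ
  simp only [Finset.mem_univ, if_true] at key
  rw [← hmap z] at key
  obtain ⟨y, hy⟩ := key
  obtain ⟨g, hg⟩ := IsIntegrallyClosed.exists_algebraMap_eq_of_isIntegral_pow (R := P) (x := y)
    (n := 2) (by norm_num) (by rw [sq, ← hy]; exact isIntegral_algebraMap)
  have : ((Polynomial.X : P) • J.map Polynomial.C +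
      (A * deltaMat z * Aᵀ).map Polynomial.C).det = g * g := by
    apply hι
    rw [hy, map_mul, ← hg]
  refine ⟨g.coeff 0, ?_⟩
  rw [← Polynomial.coeff_det_X_add_C_zero J, this, Polynomial.mul_coeff_zero]

lemma det_mod {n L R T : Type*} [CommRing R] [CommRing T] [Fintype n] [DecidableEq n] [Fintype L]
    [DecidableEq L] (f : R →+* T) (A : Matrix n (L × Fin 2) R) (z : L → R) :
    f (A * deltaMat z * Aᵀ).det =
      (A.map f * deltaMat (fun l => f (z l)) * (A.map f)ᵀ).det := by
  rw [RingHom.map_det]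
  congr 1
  rw [RingHom.mapMatrix_apply, Matrix.map_mul, Matrix.map_mul, map_delta, Matrix.transpose_map]

lemma prod_X_dvd {K L : Type*} [Field K] (S : Finset L) (g : MvPolynomial L K)
    (h : ∀ l ∈ S, MvPolynomial.X l ∣ g) : ∏ l ∈ S, (MvPolynomial.X l : MvPolynomial L K) ∣ g := by
  classical
  induction S using Finset.induction_on with
  | empty => simp
  | insert k S hk ih =>
    obtain ⟨q, hq⟩ := ih fun l hl => h l (Finset.mem_insert_of_mem hl)
    have hp : Prime (MvPolynomial.X k : MvPolynomial L K) := MvPolynomial.X_prime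
    have h1 := h k (Finset.mem_insert_self _ _)
    rw [hq] at h1
    rcases hp.dvd_or_dvd h1 with h2 | h2
    · obtain ⟨l, hl, h3⟩ := (hp.dvd_finsetProd_iff _).1 h2
      rw [MvPolynomial.X_dvd_X] at h3
      exact absurd (h3 ▸ hl) hk
    · rw [Finset.prod_insert hk, hq, mul_comm]
      exact mul_dvd_mul_left _ h2

lemma deg_le {K L n : Type*} [Field K] [Fintype L] [DecidableEq L] [Fintype n] [DecidableEq n]
    (A : Matrix n (L × Fin 2) K) (z : L → MvPolynomial L K) (hz : ∀ l, (z l).totalDegree ≤ 1) :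
    (A.map (MvPolynomial.C : K →+* MvPolynomial L K) * deltaMat z *
      (A.map (MvPolynomial.C : K →+* MvPolynomial L K))ᵀ).det.totalDegree ≤ Fintype.card n := by
  rw [Matrix.det_apply]
  refine MvPolynomial.totalDegree_finsetSum_le fun σ _ => ?_
  have : ∀ (u : ℤˣ) (p : MvPolynomial L K), (u • p).totalDegree ≤ p.totalDegree := by
    intro u p
    rcases Int.units_eq_one_or u with rfl | rfl <;> simp
  refine (this _ _).trans ((MvPolynomial.totalDegree_finsetProd _ _).trans ?_)
  refine (Finset.sum_le_card_nsmul _ _ 1 fun i _ => ?_).trans (by simp)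
  rw [entry]
  refine MvPolynomial.totalDegree_finsetSum_le fun l _ => ?_
  simp only [Matrix.map_apply, ← MvPolynomial.C_mul, ← MvPolynomial.C_sub]
  refine (MvPolynomial.totalDegree_mul _ _).trans ?_
  rw [MvPolynomial.totalDegree_C]
  exact hz l

lemma ker_det {K L n : Type*} [Field K] [Fintype L] [DecidableEq L] [Fintype n] [DecidableEq n]
    (A : Matrix n (L × Fin 2) K) (S : Finset L) (z : L → MvPolynomial L K)
    (hz : ∀ l, l ∉ S → z l = 0) (v : n → K) (hv : v ≠ 0)
    (h : ∀ l ∈ S, ∀ a, ∑ i, v i * A i (l, a) = 0) :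
    (A.map (MvPolynomial.C : K →+* MvPolynomial L K) * deltaMat z *
      (A.map (MvPolynomial.C : K →+* MvPolynomial L K))ᵀ).det = 0 := by
  rw [← Matrix.exists_vecMul_eq_zero_iff]
  refine ⟨fun i => MvPolynomial.C (v i), ?_, ?_⟩
  · intro h0
    apply hv
    ext i
    simpa using congrFun h0 i
  · ext1 j
    simp only [Matrix.vecMul, dotProduct, entry, Pi.zero_apply, Finset.mul_sum]
    rw [Finset.sum_comm]
    refine Finset.sum_eq_zero fun l _ => ?_
    by_cases hl : l ∈ S
    · have h' : ∀ a, ∑ i, (MvPolynomial.C (v i) : MvPolynomial L K) * MvPolynomial.C (A i (l, a)) = 0 := by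
        intro a
        simp only [← MvPolynomial.C_mul]
        rw [← map_sum, h l hl a, map_zero]
      have : ∀ i, (MvPolynomial.C (v i) : MvPolynomial L K) * (z l *
        ((A.map MvPolynomial.C) i (l, 0) * (A.map MvPolynomial.C) j (l, 1) -
          (A.map MvPolynomial.C) i (l, 1) * (A.map MvPolynomial.C) j (l, 0))) =
         (z l * MvPolynomial.C (A j (l, 1))) * (MvPolynomial.C (v i) * MvPolynomial.C (A i (l, 0)))
          - (z l * MvPolynomial.C (A j (l, 0))) *
            (MvPolynomial.C (v i) * MvPolynomial.C (A i (l, 1))) := by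
        intro i; simp only [Matrix.map_apply]; ring
      rw [Finset.sum_congr rfl fun i _ => this i, Finset.sum_sub_distrib, ← Finset.mul_sum,
        ← Finset.mul_sum, h', h']
      simp
    · simp [hz l hl]

/-- A matroid parity `(A, L)` over a field `K` has a parity base if and only if
`det (A * Δ_L(X) * Aᵀ)` is a nonzero element of the multivariate polynomial ring
`K[X_l : l ∈ L]`. -/
theorem parityBase_exists_iff_det_ne_zero {K : Type*} [Field K] {r : ℕ} {L : Type*}
    [Fintype L] [LinearOrder L] (A : Matrix (Fin r × Fin 2) (L × Fin 2) K) :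
    (∃ B : Finset L, B.card = r ∧ (paritySub A B).det ≠ 0)
      ↔ (A.map (MvPolynomial.C : K →+* MvPolynomial L K) *
          deltaMat (fun l => (MvPolynomial.X l : MvPolynomial L K)) *
          (A.map (MvPolynomial.C : K →+* MvPolynomial L K))ᵀ).det ≠ 0 := by
  constructor
  · rintro ⟨B, hB, hd⟩ h0
    have h1 := congrArg (MvPolynomial.eval (fun l => if l ∈ B then (1 : K) else 0)) h0
    rw [det_mod, map_zero] at h1
    have e : (A.map (MvPolynomial.C : K →+* MvPolynomial L K)).map
        (MvPolynomial.eval (fun l => if l ∈ B then (1 : K) else 0)) = A := by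
      ext i j; simp
    rw [e] at h1
    simp only [MvPolynomial.eval_X] at h1
    have e2 : A * deltaMat (fun l => if l ∈ B then (1 : K) else 0) * Aᵀ =
        paritySub A B * deltaMat (fun _ : Fin r => (1 : K)) * (paritySub A B)ᵀ := by
      ext i j
      rw [entry, entry]
      simp only [paritySub, dif_pos hB, Matrix.submatrix_apply, id, ite_mul, zero_mul, one_mul]
      rw [← Finset.sum_filter, Finset.filter_mem_eq_inter, Finset.univ_inter,
        ← Finset.sum_coe_sort B, ← Equiv.sum_comp (B.orderIsoOfFin hB).toEquiv]
      rfl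
    rw [e2, Matrix.det_mul, Matrix.det_mul, Matrix.det_transpose, delta_det, mul_one] at h1
    exact hd (mul_self_eq_zero.1 h1)
  · intro h
    let A' := A.map (MvPolynomial.C : K →+* MvPolynomial L K)
    let z : Finset L → L → MvPolynomial L K := fun S l => if l ∈ S then MvPolynomial.X l else 0
    let f : Finset L → MvPolynomial L K := fun S => (A' * deltaMat (z S) * A'ᵀ).det
    have hu : f Finset.univ ≠ 0 := by simpa [f, z, A'] using h
    obtain ⟨S, hS⟩ : ∃ S, Minimal (fun S => f S ≠ 0) S := by
      obtain ⟨S, -, hS⟩ := exists_minimal_le_of_wellFoundedLT (fun S => f S ≠ 0) _ hu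
      exact ⟨S, hS⟩
    have hS0 : f S ≠ 0 := hS.prop
    obtain ⟨g, hg⟩ : IsSquare (f S) := square_ufd A' (z S)
    have hg0 : g ≠ 0 := by
      rintro rfl
      exact hS0 (by simpa using hg)
    have hdvd : ∀ l ∈ S, MvPolynomial.X l ∣ g := by
      intro l hl
      have hp : Prime (MvPolynomial.X l : MvPolynomial L K) := MvPolynomial.X_prime
      have h0 : f (S.erase l) = 0 := by
        by_contra hne
        have := hS.le_of_le hne (Finset.erase_subset _ _) hl
        simp at this
      have h1 : MvPolynomial.X l ∣ f S := by
        rw [← Ideal.mem_span_singleton, ← Ideal.Quotient.eq_zero_iff_mem,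
          ← map_zero (Ideal.Quotient.mk _), ← h0]
        simp only [f]
        rw [det_mod, det_mod]
        congr 4
        ext1 k
        by_cases hk : k = l
        · subst hk
          simp only [z, hl, if_true, Finset.notMem_erase, if_false, map_zero]
          rw [Ideal.Quotient.eq_zero_iff_mem, Ideal.mem_span_singleton]
        · simp [z, hk]
      rw [hg] at h1
      rcases hp.dvd_or_dvd h1 with h2 | h2 <;> exact h2
    have hcard : S.card ≤ r := by
      have h1 := MvPolynomial.totalDegree_le_of_dvd_of_isDomain (prod_X_dvd S g hdvd) hg0
      have h2 : (∏ l ∈ S, (MvPolynomial.X l : MvPolynomial L K)).totalDegree = S.card := by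
        refine MvPolynomial.IsHomogeneous.totalDegree ?_ ?_
        · simpa using MvPolynomial.IsHomogeneous.prod S
            (fun l => (MvPolynomial.X l : MvPolynomial L K)) (fun _ => 1)
            (fun l _ => MvPolynomial.isHomogeneous_X K l)
        · exact Finset.prod_ne_zero_iff.2 fun l _ => MvPolynomial.X_ne_zero l
      have h3 : (f S).totalDegree ≤ r * 2 := by
        simpa using deg_le A (z S) (by
          intro l
          simp only [z]
          split_ifs <;> simp)
      rw [hg, MvPolynomial.totalDegree_mul_of_isDomain hg0 hg0] at h3
      omega
    have hker : ∀ v : Fin r × Fin 2 → K, (∀ l ∈ S, ∀ a, ∑ i, v i * A i (l, a) = 0) → v = 0 := by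
      intro v hv
      by_contra hne
      exact hS0 (ker_det A S (z S) (fun l hl => by simp [z, hl]) v hne hv)
    have hcard' : S.card = r := by
      refine le_antisymm hcard ?_
      by_contra hlt
      let T := (A.submatrix id (fun p : S × Fin 2 => (p.1.1, p.2))).vecMulLinear
      have : LinearMap.ker T ≠ ⊥ := LinearMap.ker_ne_bot_of_finrank_lt (by
        simp; omega)
      obtain ⟨v, hv, hv0⟩ := Submodule.exists_mem_ne_zero_of_ne_bot this
      refine hv0 (hker v fun l hl a => ?_)
      have := congrFun (LinearMap.mem_ker.1 hv) (⟨l, hl⟩, a)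
      simpa [T, Matrix.vecMul, dotProduct] using this
    refine ⟨S, hcard', fun hdet => ?_⟩
    obtain ⟨v, hv0, hv⟩ := Matrix.exists_vecMul_eq_zero_iff.2 hdet
    refine hv0 (hker v fun l hl a => ?_)
    have := congrFun hv ((S.orderIsoOfFin hcard').symm ⟨l, hl⟩, a)
    simp only [paritySub, dif_pos hcard', Matrix.vecMul, dotProduct, Matrix.submatrix_apply, id,
      ← Finset.coe_orderIsoOfFin_apply, OrderIso.apply_symm_apply] at this
    simpa using this
end

section
/- Let (A, L) be a Pfaffian parity of constant c over a field K. Then det(A · Δ_L(1) · Aᵀ) = ( c · (|B(A,L)| : K) )², where 1 denotes the all-ones vector indexed by L and the cardinality of the set of parity bases is cast into K. (Equivalently, the number of parity bases modulo the characteristic of K equals c⁻¹ · pf(A Δ_L(1) Aᵀ).) -/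
open Matrix

namespace PPC

lemma M_apply {K : Type*} [CommRing K] {m : Type*} {L : Type*} [Fintype L]
    [DecidableEq L] (A : Matrix m (L × Fin 2) K) (i j : m) :
    (A * deltaMat (fun _ : L => (1 : K)) * Aᵀ) i j
      = ∑ l, (A i (l, 0) * A j (l, 1) - A i (l, 1) * A j (l, 0)) := by
  simp only [Matrix.mul_apply, Fintype.sum_prod_type, Fin.sum_univ_two, deltaMat, Matrix.of_apply,
    Matrix.transpose_apply]
  refine Finset.sum_congr rfl fun l _ => ?_
  simp
  ring

/-- The raw signed sum. -/
def F {K : Type*} [CommRing K] {r : ℕ} (M : Matrix (Fin r × Fin 2) (Fin r × Fin 2) K) : K :=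
  ∑ σ : Equiv.Perm (Fin r × Fin 2), ((Equiv.Perm.sign σ : ℤ) : K) * ∏ i, M (σ (i, 0)) (σ (i, 1))

def N {K : Type*} [CommRing K] {m : Type*} {L : Type*} [Fintype L]
    (A : Matrix m (L × Fin 2) K) : Matrix m m K :=
  Matrix.of fun i j => ∑ l, A i (l, 0) * A j (l, 1)

def subF {K : Type*} {r : ℕ} {m L : Type*} (A : Matrix m (L × Fin 2) K) (f : Fin r → L) :
    Matrix m (Fin r × Fin 2) K := A.submatrix id (fun p => (f p.1, p.2))

lemma sum_det_eq {K : Type*} [CommRing K] {r : ℕ} {L : Type*} [Fintype L] [DecidableEq L]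
    (A : Matrix (Fin r × Fin 2) (L × Fin 2) K) :
    ∑ f : Fin r → L, (subF A f).det = F (N A) := by
  simp only [Matrix.det_apply', F, N, subF, Matrix.of_apply]
  rw [Finset.sum_comm]
  refine Finset.sum_congr rfl fun σ _ => ?_
  rw [← Finset.mul_sum]
  congr 1
  rw [Finset.prod_univ_sum, Fintype.piFinset_univ]
  refine Finset.sum_congr rfl fun f _ => ?_
  simp [Fintype.prod_prod_type, Fin.prod_univ_two]

def tau {r : ℕ} (e : Fin r → Fin 2) : Equiv.Perm (Fin r × Fin 2) :=
  Equiv.prodCongrRight fun i => Equiv.addRight (e i)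

lemma sign_tau {r : ℕ} (e : Fin r → Fin 2) :
    Equiv.Perm.sign (tau e) = ∏ i, (-1 : ℤˣ) ^ (e i : ℕ) := by
  have h : ∀ x : Fin 2, Equiv.Perm.sign (Equiv.addRight x) = (-1 : ℤˣ) ^ (x : ℕ) := by decide
  rw [tau, Equiv.Perm.sign_prodCongrRight]
  exact Finset.prod_congr rfl fun i _ => h _

lemma F_alt {K : Type*} [CommRing K] {r : ℕ} (M : Matrix (Fin r × Fin 2) (Fin r × Fin 2) K) :
    F (M - Mᵀ) = 2 ^ r * F M := by
  have h1 : ∀ σ : Equiv.Perm (Fin r × Fin 2),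
      ∏ i, (M - Mᵀ) (σ (i, 0)) (σ (i, 1))
        = ∑ e : Fin r → Fin 2, ∏ i, ((-1 : K) ^ (e i : ℕ) * M (σ (i, e i)) (σ (i, 1 + e i))) := by
    intro σ
    rw [← Fintype.piFinset_univ, ← Finset.prod_univ_sum (fun _ => Finset.univ)
      (fun i (x : Fin 2) => ((-1 : K) ^ (x : ℕ) * M (σ (i, x)) (σ (i, 1 + x))))]
    refine Finset.prod_congr rfl fun i _ => ?_
    simp [Fin.sum_univ_two, sub_eq_add_neg]
  have h2 : ∀ e : Fin r → Fin 2, ∑ σ : Equiv.Perm (Fin r × Fin 2),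
      ((Equiv.Perm.sign σ : ℤ) : K) *
        ∏ i, ((-1 : K) ^ (e i : ℕ) * M (σ (i, e i)) (σ (i, 1 + e i))) = F M := by
    intro e
    symm
    rw [F, ← Equiv.sum_comp (Equiv.mulRight (tau e))]
    refine Finset.sum_congr rfl fun σ _ => ?_
    rw [Finset.prod_mul_distrib (f := fun i => (-1 : K) ^ (e i : ℕ))]
    have : (Equiv.mulRight (tau e)) σ = σ * tau e := rfl
    simp only [this, Equiv.Perm.sign_mul, sign_tau, Equiv.Perm.mul_apply]
    simp only [tau, Equiv.prodCongrRight_apply, Equiv.coe_addRight, zero_add]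
    push_cast
    ring
  have h3 : F (M - Mᵀ) = ∑ e : Fin r → Fin 2, F M := by
    rw [(Finset.sum_congr rfl (fun e _ => (h2 e).symm) : ∑ e : Fin r → Fin 2, F M = _)]
    rw [F, Finset.sum_comm]
    refine Finset.sum_congr rfl fun σ _ => ?_
    rw [h1, Finset.mul_sum]
  rw [h3]
  simp

lemma M_eq {K : Type*} [CommRing K] {m : Type*} {L : Type*} [Fintype L]
    [DecidableEq L] (A : Matrix m (L × Fin 2) K) :
    A * deltaMat (fun _ : L => (1 : K)) * Aᵀ = N A - (N A)ᵀ := by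
  ext i j
  rw [M_apply]
  simp [N, mul_comm]

lemma sum_fun {K : Type*} [CommRing K] {r : ℕ} {L : Type*} [Fintype L] [LinearOrder L]
    (A : Matrix (Fin r × Fin 2) (L × Fin 2) K) :
    ∑ f : Fin r → L, (subF A f).det
      = (r.factorial : K) * ∑ B ∈ Finset.univ.powersetCard r, (paritySub A B).det := by
  have e1 : ∑ B ∈ Finset.univ.powersetCard r, (paritySub A B).det
      = ∑ B : {B : Finset L // B.card = r}, (paritySub A B.1).det := by
    apply Finset.sum_subtype
    simp [Finset.mem_powersetCard]
  rw [e1]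
  have e2 : ∑ x : {B : Finset L // B.card = r} × Equiv.Perm (Fin r), (paritySub A x.1.1).det
      = (r.factorial : K) * ∑ B : {B : Finset L // B.card = r}, (paritySub A B.1).det := by
    rw [Fintype.sum_prod_type]
    simp [Fintype.card_perm, Finset.mul_sum]
  rw [← e2]
  symm
  refine Finset.sum_of_injOn
    (fun x : {B : Finset L // B.card = r} × Equiv.Perm (Fin r) =>
      fun i => x.1.1.orderEmbOfFin x.1.2 (x.2 i)) ?_ ?_ ?_ ?_
  · rintro ⟨⟨B, hB⟩, σ⟩ - ⟨⟨B', hB'⟩, σ'⟩ - h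
    dsimp only at h
    have hr : ∀ (C : Finset L) (hC : C.card = r) (ρ : Equiv.Perm (Fin r)),
        Set.range (fun i => C.orderEmbOfFin hC (ρ i)) = C := by
      intro C hC ρ
      rw [← Finset.range_orderEmbOfFin C hC]
      exact ρ.surjective.range_comp (C.orderEmbOfFin hC)
    have hBB : B = B' := by
      apply Finset.coe_injective
      rw [← hr B hB σ, ← hr B' hB' σ', h]
    subst hBB
    congr 1
    ext1 i
    exact (B.orderEmbOfFin hB).injective (congrFun h i)
  · intro x _
    simp
  · intro f _ hf
    by_cases hinj : Function.Injective f
    · exfalso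
      apply hf
      have hB : (Finset.univ.image f).card = r := by
        rw [Finset.card_image_of_injective _ hinj]; simp
      have hex : ∀ i, ∃ j, (Finset.univ.image f).orderEmbOfFin hB j = f i := by
        intro i
        have : f i ∈ Set.range ((Finset.univ.image f).orderEmbOfFin hB) := by
          rw [Finset.range_orderEmbOfFin]; simp
        exact this
      choose g hg using hex
      have hgi : Function.Injective g := by
        intro a b hab
        apply hinj
        rw [← hg, ← hg, hab]
      refine ⟨(⟨_, hB⟩, Equiv.ofBijective g (Finite.injective_iff_bijective.1 hgi)), by simp, ?_⟩
      ext i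
      exact hg i
    · simp only [Function.Injective, not_forall] at hinj
      obtain ⟨a, b, hab, hne⟩ := hinj
      refine Matrix.det_zero_of_column_eq (i := (a, 0)) (j := (b, 0)) (by simp [hne]) ?_
      intro k
      simp [subF, hab]
  · rintro ⟨⟨B, hB⟩, σ⟩ -
    have : subF A (fun i => B.orderEmbOfFin hB (σ i))
        = (paritySub A B).submatrix id (Equiv.prodCongrLeft (fun _ : Fin 2 => σ)) := by
      ext i j
      simp [subF, paritySub, hB]
    dsimp only
    rw [this, Matrix.det_permute', Equiv.Perm.sign_prodCongrLeft]
    simp [Int.units_mul_self, ← Int.cast_mul]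

lemma decomp {K : Type*} [Field K] {m : Type*} [Fintype m] [DecidableEq m] (k : ℕ) :
    ∀ (S : Finset m) (M : Matrix m m K), S.card ≤ 2 * k → (∀ i, M i i = 0) →
      (∀ i j, M j i = - M i j) → (∀ i j, i ∉ S → M i j = 0) →
      ∃ X : Matrix m (Fin k × Fin 2) K,
        M = X * deltaMat (fun _ : Fin k => (1 : K)) * Xᵀ := by
  induction k with
  | zero =>
    intro S M hS _ _ h
    refine ⟨0, ?_⟩
    ext i j
    have : S = ∅ := by simpa using hS
    rw [h i j (by simp [this])]
    simp
  | succ k ih =>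
    intro S M hS hd ha h
    by_cases hM : M = 0
    · exact ⟨0, by simp [hM]⟩
    have : ∃ a b, M a b ≠ 0 := by
      by_contra! hh
      exact hM (by ext i j; simpa using hh i j)
    obtain ⟨a, b, hab⟩ := this
    have hne : a ≠ b := by
      rintro rfl
      exact hab (hd a)
    have haS : a ∈ S := by
      by_contra hh
      exact hab (h _ _ hh)
    have hbS : b ∈ S := by
      by_contra hh
      exact hab (by rw [ha b a, h _ _ hh, neg_zero])
    obtain ⟨X, hX⟩ := ih ((S.erase a).erase b)
      (Matrix.of fun i j => M i j - (M i b * M a j - M i a * M b j) / M a b)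
      (by
        rw [Finset.card_erase_of_mem (by simp [hne.symm, hbS]), Finset.card_erase_of_mem haS]
        omega)
      (by
        intro i
        simp only [Matrix.of_apply, hd i, ha i a, ha i b]
        ring)
      (by
        intro i j
        simp only [Matrix.of_apply, ha i j, ha j b, ha i a, ha j a, ha i b]
        ring)
      (by
        intro i j hi
        simp only [Matrix.of_apply]
        by_cases hia : i = a
        · subst hia
          rw [hd]; field_simp; ring
        by_cases hib : i = b
        · subst hib
          rw [hd, ha a i]; field_simp; ring
        have : i ∉ S := by simpa [hia, hib] using hi
        simp [h i _ this])
    refine ⟨Matrix.of fun i p => Fin.cases (motive := fun _ => K)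
      (if p.2 = 0 then - M i b / M a b else M i a) (fun q => X i (q, p.2)) p.1, ?_⟩
    ext i j
    have := congrFun (congrFun hX i) j
    rw [M_apply] at this ⊢
    rw [Fin.sum_univ_succ]
    simp only [Matrix.of_apply, Fin.cases_zero, Fin.cases_succ] at this ⊢
    rw [← this, ha j a, ha j b]
    simp
    ring

lemma det_delta (r : ℕ) {K : Type*} [CommRing K] :
    (deltaMat (fun _ : Fin r => (1 : K))).det = 1 := by
  have : deltaMat (fun _ : Fin r => (1 : K))
      = (Matrix.blockDiagonal (fun _ : Fin r => !![(0 : K), 1; -1, 0])).submatrix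
        (Equiv.prodComm _ _) (Equiv.prodComm _ _) := by
    ext ⟨i, x⟩ ⟨j, y⟩
    fin_cases x <;> fin_cases y <;> simp [deltaMat, Matrix.blockDiagonal_apply]
  rw [this, Matrix.det_submatrix_equiv_self, Matrix.det_blockDiagonal]
  simp [Matrix.det_fin_two]

lemma charZero_case {K : Type*} [Field K] [CharZero K] {r : ℕ} {L : Type*} [Fintype L]
    [LinearOrder L] (A : Matrix (Fin r × Fin 2) (L × Fin 2) K) :
    (A * deltaMat (fun _ : L => (1 : K)) * Aᵀ).det
      = (∑ B ∈ Finset.univ.powersetCard r, (paritySub A B).det) ^ 2 := by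
  obtain ⟨X, hX⟩ := decomp r Finset.univ (A * deltaMat (fun _ : L => (1 : K)) * Aᵀ)
    (by simp [mul_comm]) (by intro i; rw [M_eq]; simp) (by intro i j; rw [M_eq]; simp)
    (by simp)
  have hF : ∀ {L : Type _} [Fintype L] [LinearOrder L]
      (A : Matrix (Fin r × Fin 2) (L × Fin 2) K),
      F (A * deltaMat (fun _ : L => (1 : K)) * Aᵀ) = 2 ^ r * ((r.factorial : K) *
        ∑ B ∈ Finset.univ.powersetCard r, (paritySub A B).det) := by
    intro L _ _ A
    rw [M_eq, F_alt, ← sum_det_eq, sum_fun]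
  have hF' : F (X * deltaMat (fun _ : Fin r => (1 : K)) * Xᵀ) = 2 ^ r * ((r.factorial : K) *
        ∑ B ∈ Finset.univ.powersetCard r, (paritySub X B).det) := by
    rw [M_eq, F_alt, ← sum_det_eq, sum_fun]
  have h1 := hF A
  rw [hX, hF'] at h1
  have h2 := mul_left_cancel₀ (Nat.cast_ne_zero.2 r.factorial_ne_zero)
    (mul_left_cancel₀ (pow_ne_zero r two_ne_zero) h1)
  have h3 : ∑ B ∈ Finset.univ.powersetCard r, (paritySub X B).det = X.det := by
    have hc : (Finset.univ : Finset (Fin r)).card = r := by simp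
    have : Finset.univ.powersetCard r = {(Finset.univ : Finset (Fin r))} := by
      ext B
      rw [Finset.mem_powersetCard, Finset.mem_singleton, ← Finset.card_eq_iff_eq_univ]
      simp
    rw [this, Finset.sum_singleton]
    congr 1
    have he : ∀ i, (Finset.univ : Finset (Fin r)).orderEmbOfFin hc i = i := by
      intro i
      have := Finset.orderEmbOfFin_unique hc (f := id) (by simp) strictMono_id
      exact (congrFun this i).symm
    ext i j
    simp [paritySub, he]
  rw [hX, ← h2, h3, Matrix.det_mul, Matrix.det_mul, det_delta, Matrix.det_transpose]
  ring

lemma paritySub_map {R S : Type*} [CommRing R] [CommRing S] (φ : R →+* S) {r : ℕ} {L : Type*}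
    [Fintype L] [LinearOrder L] (A : Matrix (Fin r × Fin 2) (L × Fin 2) R) (B : Finset L) :
    (paritySub (A.map φ) B).det = φ (paritySub A B).det := by
  rw [RingHom.map_det]
  congr 1
  by_cases h : B.card = r
  · ext i j; simp [paritySub, h]
  · ext i j; simp [paritySub, h]

lemma lhs_map {R S : Type*} [CommRing R] [CommRing S] (φ : R →+* S) {r : ℕ} {L : Type*}
    [Fintype L] [LinearOrder L] (A : Matrix (Fin r × Fin 2) (L × Fin 2) R) :
    (A.map φ * deltaMat (fun _ : L => (1 : S)) * (A.map φ)ᵀ).det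
      = φ (A * deltaMat (fun _ : L => (1 : R)) * Aᵀ).det := by
  rw [RingHom.map_det]
  congr 1
  ext i j
  simp only [RingHom.mapMatrix_apply, Matrix.map_apply, M_apply, map_sum, map_sub, map_mul]

lemma general {K : Type*} [CommRing K] {r : ℕ} {L : Type*} [Fintype L]
    [LinearOrder L] (A : Matrix (Fin r × Fin 2) (L × Fin 2) K) :
    (A * deltaMat (fun _ : L => (1 : K)) * Aᵀ).det
      = (∑ B ∈ Finset.univ.powersetCard r, (paritySub A B).det) ^ 2 := by
  let R := MvPolynomial ((Fin r × Fin 2) × (L × Fin 2)) ℤ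
  let Y : Matrix (Fin r × Fin 2) (L × Fin 2) R := Matrix.of fun i j => MvPolynomial.X (i, j)
  have hY : (Y * deltaMat (fun _ : L => (1 : R)) * Yᵀ).det
      = (∑ B ∈ Finset.univ.powersetCard r, (paritySub Y B).det) ^ 2 := by
    apply IsFractionRing.injective R (FractionRing R)
    haveI : CharZero (FractionRing R) :=
      charZero_of_injective_algebraMap (IsFractionRing.injective R (FractionRing R))
    have := charZero_case (Y.map (algebraMap R (FractionRing R)))
    rw [lhs_map] at this
    simp only [paritySub_map] at this
    rw [this, map_pow, map_sum]
  let φ : R →+* K := MvPolynomial.eval₂Hom (Int.castRingHom K) (fun p => A p.1 p.2)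
  have hA : A = Y.map φ := by
    ext i j
    exact (MvPolynomial.eval₂Hom_X' (Int.castRingHom K) (fun p => A p.1 p.2) (i, j)).symm
  rw [hA, lhs_map, hY]
  simp only [paritySub_map, map_pow, map_sum]

end PPC


/-- For a Pfaffian parity `(A, L)` of constant `c` over a field `K`,
`det (A * Δ_L(1) * Aᵀ) = (c * |B(A,L)|)²` in `K`; equivalently, the number of parity bases
modulo the characteristic of `K` equals `c⁻¹ * pf (A Δ_L(1) Aᵀ)`. -/
theorem pfaffian_parity_counting {K : Type*} [Field K] {r : ℕ} {L : Type*} [Fintype L]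
    [LinearOrder L] (A : Matrix (Fin r × Fin 2) (L × Fin 2) K) (c : K) (hc : c ≠ 0)
    (hPf : ∀ B ∈ parityBases A, (paritySub A B).det = c) :
    (A * deltaMat (fun _ : L => (1 : K)) * Aᵀ).det
      = (c * ((parityBases A).card : K)) ^ 2 := by
  rw [PPC.general]
  congr 1
  have h1 : ∑ B ∈ Finset.univ.powersetCard r, (paritySub A B).det
      = ∑ B ∈ parityBases A, (paritySub A B).det := by
    symm
    apply Finset.sum_subset
    · intro B hB
      simp only [parityBases, Finset.mem_filter] at hB
      simp [Finset.mem_powersetCard, hB.2.1]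
    · intro B hB hB'
      simp only [Finset.mem_powersetCard] at hB
      by_contra hne
      apply hB'
      simp [parityBases, hB.2, hne]
  rw [h1, Finset.sum_congr rfl hPf, Finset.sum_const, nsmul_eq_mul, mul_comm]
end

section
/- Let S be an n×n skew-symmetric principally unimodular matrix over ℚ with row and column set E, and define the n×2n matrices A1 = (S | I_n) and A2 = (I_n | I_n), with common column set E ∪ Ē where Ē is a disjoint copy of E indexing the right blocks. Then: (i) (A1, A2) is a Pfaffian pair with constant 1, i.e., det A1[B] · det A2[B] = 1 for every common base B; and (ii) B ↦ B ∩ E is a bijection from the set of common bases of (A1, A2) onto the set {F ⊆ E : S[F, F] is nonsingular} of feasible sets of D(S). -/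
open Matrix

instance {α : Type*} [Fintype α] : Fintype (Lex α) := ‹Fintype α›

/-- The square submatrix of `A` formed by the columns in `B` taken in increasing order,
matched against the rows of `A` taken in increasing order (junk value `0` if
`B.card ≠ |ι|`). -/
noncomputable def colSubE {K : Type*} [CommRing K] {ι F : Type*} [Fintype ι] [LinearOrder ι]
    [Fintype F] [LinearOrder F] (A : Matrix ι F K) (B : Finset F) : Matrix ι ι K :=
  if h : B.card = Fintype.card ι then
    A.submatrix id (fun i =>
      B.orderEmbOfFin h ((Finset.univ.orderIsoOfFin Finset.card_univ).symm ⟨i, Finset.mem_univ i⟩))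
  else 0

/-- The principal submatrix of `S` with rows and columns in `F`. -/
def prinSub {E : Type*} (S : Matrix E E ℚ) (F : Finset E) : Matrix F F ℚ :=
  S.submatrix (fun x => (x : E)) (fun x => (x : E))

/-- The matrix `A1 = (S | I)` with columns `E ⊕ Ē` (lexicographically ordered, `E` first). -/
def augA1 {E : Type*} [Fintype E] [LinearOrder E] (S : Matrix E E ℚ) :
    Matrix E (E ⊕ₗ E) ℚ :=
  Matrix.of fun i q =>
    Sum.elim (fun j => S i j) (fun j => if i = j then 1 else 0) (ofLex q)

/-- The matrix `A2 = (I | I)` with columns `E ⊕ Ē` (lexicographically ordered, `E` first). -/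
def augA2 {E : Type*} [Fintype E] [LinearOrder E] : Matrix E (E ⊕ₗ E) ℚ :=
  Matrix.of fun i q =>
    Sum.elim (fun j => if i = j then (1 : ℚ) else 0) (fun j => if i = j then 1 else 0) (ofLex q)

/-- The part `B ∩ E` of a subset `B ⊆ E ∪ Ē`. -/
noncomputable def leftPart {E : Type*} [Fintype E] [LinearOrder E] (B : Finset (E ⊕ₗ E)) :
    Finset E := by
  classical
  exact Finset.univ.filter (fun j => toLex (Sum.inl j) ∈ B)


theorem skew_det_real {n : Type*} [Fintype n] [DecidableEq n] (S : Matrix n n ℝ)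
    (h : Sᵀ = -S) : 0 ≤ S.det := by
  by_contra hneg
  push Not at hneg
  let f : ℝ → ℝ := fun t => ((1 - t) • (1 : Matrix n n ℝ) + t • S).det
  have hf : Continuous f := by
    apply Continuous.matrix_det
    fun_prop
  have h0 : f 0 = 1 := by simp [f]
  have h1 : f 1 = S.det := by simp [f]
  have hm : (0 : ℝ) ∈ Set.Icc (f 1) (f 0) := by
    rw [h0, h1]; exact ⟨hneg.le, zero_le_one⟩
  obtain ⟨t, ht, hft⟩ := intermediate_value_Icc' (zero_le_one) hf.continuousOn hm
  have ht1 : t ≠ 1 := by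
    rintro rfl
    rw [h1] at hft; linarith
  obtain ⟨x, hx0, hx⟩ := Matrix.exists_mulVec_eq_zero_iff.mpr hft
  have hS : x ⬝ᵥ (S *ᵥ x) = 0 := by
    have h2 : x ⬝ᵥ (S *ᵥ x) = - (x ⬝ᵥ (S *ᵥ x)) := by
      conv_lhs => rw [Matrix.dotProduct_mulVec, ← Matrix.mulVec_transpose, h, Matrix.neg_mulVec,
        neg_dotProduct, dotProduct_comm]
    linarith
  have h3 := congrArg (fun v => x ⬝ᵥ v) hx
  simp only [Matrix.add_mulVec, Matrix.smul_mulVec, Matrix.one_mulVec, dotProduct_add,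
    dotProduct_smul, hS, dotProduct_zero, smul_eq_mul, mul_zero, add_zero] at h3
  rcases mul_eq_zero.mp h3 with h4 | h4
  · exact ht1 (by linarith)
  · exact hx0 (dotProduct_self_eq_zero.mp h4)

theorem skew_det_rat {n : Type*} [Fintype n] [DecidableEq n] (S : Matrix n n ℚ)
    (h : Sᵀ = -S) : 0 ≤ S.det := by
  have h1 := skew_det_real (S.map ((↑) : ℚ → ℝ)) (by
    ext i j
    have := congrFun (congrFun h i) j
    simp only [transpose_apply, neg_apply] at this
    simp [this])
  have h2 : (S.map ((↑) : ℚ → ℝ)).det = ((S.det : ℚ) : ℝ) :=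
    ((Rat.castHom ℝ).map_det S).symm
  rw [h2] at h1
  exact_mod_cast h1

/-- projection -/
def projE {E : Type*} (q : E ⊕ₗ E) : E := Sum.elim id id (ofLex q)

/-- mixed matrix -/
def mixM {E : Type*} [LinearOrder E] (S : Matrix E E ℚ) (F : Finset E) : Matrix E E ℚ :=
  Matrix.of fun i j => if j ∈ F then S i j else if i = j then 1 else 0

theorem det_mixM {E : Type*} [Fintype E] [LinearOrder E] (S : Matrix E E ℚ) (F : Finset E) :
    (mixM S F).det = (prinSub S F).det := by
  rw [Matrix.twoBlockTriangular_det' (mixM S F) (fun j => j ∈ F)]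
  · have h1 : (toSquareBlockProp (mixM S F) fun j => j ∉ F) = 1 := by
      ext ⟨i, hi⟩ ⟨j, hj⟩
      simp [toSquareBlockProp_def, mixM, hj, Matrix.one_apply]
    have h2 : (toSquareBlockProp (mixM S F) fun j => j ∈ F) = prinSub S F := by
      ext ⟨i, hi⟩ ⟨j, hj⟩
      simp [toSquareBlockProp_def, mixM, hj, prinSub]
    rw [h1, det_one, mul_one, h2]
    congr!
  · intro i hi j hj
    have : i ≠ j := by rintro rfl; exact hj hi
    simp [mixM, hj, this]

/-- enumeration -/
noncomputable def enumB {E : Type*} [Fintype E] [LinearOrder E] (B : Finset (E ⊕ₗ E))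
    (h : B.card = Fintype.card E) (i : E) : E ⊕ₗ E :=
  B.orderEmbOfFin h ((Finset.univ.orderIsoOfFin Finset.card_univ).symm ⟨i, Finset.mem_univ i⟩)

theorem enumB_inj {E : Type*} [Fintype E] [LinearOrder E] (B : Finset (E ⊕ₗ E))
    (h : B.card = Fintype.card E) : Function.Injective (enumB B h) := by
  intro i j hij
  have := (OrderIso.injective _) ((B.orderEmbOfFin h).injective hij)
  exact congrArg Subtype.val this

theorem enumB_mem {E : Type*} [Fintype E] [LinearOrder E] (B : Finset (E ⊕ₗ E))
    (h : B.card = Fintype.card E) (i : E) : enumB B h i ∈ B :=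
  Finset.orderEmbOfFin_mem _ _ _

theorem enumB_surj {E : Type*} [Fintype E] [LinearOrder E] (B : Finset (E ⊕ₗ E))
    (h : B.card = Fintype.card E) (q : E ⊕ₗ E) (hq : q ∈ B) : ∃ i, enumB B h i = q := by
  have h1 : Finset.univ.image (enumB B h) = B := by
    apply Finset.eq_of_subset_of_card_le
    · intro x hx
      obtain ⟨i, -, rfl⟩ := Finset.mem_image.mp hx
      exact enumB_mem B h i
    · rw [Finset.card_image_of_injective _ (enumB_inj B h), h, Finset.card_univ]
  rw [← h1] at hq
  obtain ⟨i, -, hi⟩ := Finset.mem_image.mp hq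
  exact ⟨i, hi⟩

theorem augA2_apply {E : Type*} [Fintype E] [LinearOrder E] (i : E) (q : E ⊕ₗ E) :
    augA2 i q = (1 : Matrix E E ℚ) i (projE q) := by
  rcases h : ofLex q with j | j <;> simp [augA2, projE, h, Matrix.one_apply]

theorem colSubE_eq {E : Type*} [Fintype E] [LinearOrder E] (A : Matrix E (E ⊕ₗ E) ℚ)
    (B : Finset (E ⊕ₗ E)) (h : B.card = Fintype.card E) :
    colSubE A B = A.submatrix id (enumB B h) := by
  unfold colSubE
  rw [dif_pos h]
  rfl

theorem inj_of_det {E : Type*} [Fintype E] [LinearOrder E]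
    (B : Finset (E ⊕ₗ E)) (h : B.card = Fintype.card E)
    (hd : (colSubE (augA2 (E := E)) B).det ≠ 0) :
    Function.Injective (fun i => projE (enumB B h i)) := by
  intro i j hij
  by_contra hne
  apply hd
  rw [colSubE_eq _ _ h]
  apply Matrix.det_zero_of_column_eq hne
  intro k
  simp only [submatrix_apply, id, augA2_apply]
  exact congrArg _ hij

theorem mem_leftPart {E : Type*} [Fintype E] [LinearOrder E] (B : Finset (E ⊕ₗ E)) (x : E) :
    x ∈ leftPart B ↔ toLex (Sum.inl x) ∈ B := by
  simp [leftPart]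

theorem key {E : Type*} [Fintype E] [LinearOrder E] (S : Matrix E E ℚ)
    (B : Finset (E ⊕ₗ E)) (h : B.card = Fintype.card E)
    (hi : Function.Injective (fun i => projE (enumB B h i))) :
    ∃ s : ℚ, s * s = 1 ∧ (colSubE (augA2 (E := E)) B).det = s ∧
      (colSubE (augA1 S) B).det = s * (prinSub S (leftPart B)).det := by
  let σ : Equiv.Perm E := Equiv.ofBijective _ (Finite.injective_iff_bijective.mp hi)
  have hσ : ∀ i, σ i = projE (enumB B h i) := fun i => rfl
  refine ⟨((Equiv.Perm.sign σ : ℤˣ) : ℤ), ?_, ?_, ?_⟩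
  · rcases Int.units_eq_one_or (Equiv.Perm.sign σ) with h | h <;> simp [h]
  · have : colSubE (augA2 (E := E)) B = (1 : Matrix E E ℚ).submatrix id σ := by
      rw [colSubE_eq _ _ h]
      ext i j
      simp only [submatrix_apply, augA2_apply]
      rfl
    rw [this, Matrix.det_permute', det_one, mul_one]
  · have : colSubE (augA1 S) B = (mixM S (leftPart B)).submatrix id σ := by
      rw [colSubE_eq _ _ h]
      ext i j
      simp only [submatrix_apply, hσ, id]
      have hm := enumB_mem B h j
      rcases hq : ofLex (enumB B h j) with x | x
      · have hq' : enumB B h j = toLex (Sum.inl x) := hq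
        have hx : x ∈ leftPart B := by rw [mem_leftPart, ← hq']; exact hm
        have hp : projE (enumB B h j) = x := by rw [hq']; rfl
        simp [augA1, hq, hp, mixM, hx]
      · have hq' : enumB B h j = toLex (Sum.inr x) := hq
        have hp : projE (enumB B h j) = x := by rw [hq']; rfl
        have hx : x ∉ leftPart B := by
          rw [mem_leftPart]
          intro hx
          obtain ⟨k, hk⟩ := enumB_surj B h _ hx
          have : k = j := hi (by
            change projE (enumB B h k) = projE (enumB B h j)
            rw [hp, hk]; rfl)
          subst this
          rw [hk] at hq
          simp at hq
        simp [augA1, hq, hp, mixM, hx]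
    rw [this, Matrix.det_permute', det_mixM]

theorem mem_inr {E : Type*} [Fintype E] [LinearOrder E]
    (B : Finset (E ⊕ₗ E)) (h : B.card = Fintype.card E)
    (hi : Function.Injective (fun i => projE (enumB B h i))) (x : E) :
    toLex (Sum.inr x) ∈ B ↔ x ∉ leftPart B := by
  rw [mem_leftPart]
  constructor
  · intro h1 h2
    obtain ⟨k, hk⟩ := enumB_surj B h _ h1
    obtain ⟨l, hl⟩ := enumB_surj B h _ h2
    have : k = l := hi (by
      change projE (enumB B h k) = projE (enumB B h l)
      rw [hl, hk]; rfl)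
    subst this
    rw [hk] at hl
    simp at hl
  · intro h1
    obtain ⟨k, hk⟩ := (Finite.injective_iff_surjective.mp hi) x
    have hm := enumB_mem B h k
    rcases hq : ofLex (enumB B h k) with y | y
    · have hq' : enumB B h k = toLex (Sum.inl y) := hq
      have hp : projE (enumB B h k) = y := by rw [hq']; rfl
      have : y = x := hp.symm.trans hk
      subst this
      rw [hq'] at hm
      exact absurd hm h1
    · have hq' : enumB B h k = toLex (Sum.inr y) := hq
      have hp : projE (enumB B h k) = y := by rw [hq']; rfl
      have : y = x := hp.symm.trans hk
      subst this
      rw [hq'] at hm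
      exact hm

theorem surjB {E : Type*} [Fintype E] [LinearOrder E] (F : Finset E) :
    ∃ B : Finset (E ⊕ₗ E), ∃ h : B.card = Fintype.card E, leftPart B = F ∧
      Function.Injective (fun i => projE (enumB B h i)) := by
  let g : E → E ⊕ₗ E := fun x => if x ∈ F then toLex (Sum.inl x) else toLex (Sum.inr x)
  have hg : ∀ x, projE (g x) = x := by
    intro x
    by_cases hx : x ∈ F <;> simp [g, hx, projE]
  have hgi : Function.Injective g := Function.LeftInverse.injective hg
  have hc : (Finset.univ.image g).card = Fintype.card E := by
    rw [Finset.card_image_of_injective _ hgi, Finset.card_univ]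
  refine ⟨Finset.univ.image g, hc, ?_, ?_⟩
  · ext x
    rw [mem_leftPart, Finset.mem_image]
    constructor
    · rintro ⟨y, -, hy⟩
      have hyx : y = x := by rw [← hg y, hy]; rfl
      subst hyx
      by_contra hF
      simp [g, hF] at hy
    · intro hx
      exact ⟨x, Finset.mem_univ _, by simp [g, hx]⟩
  · intro i j hij
    apply enumB_inj _ hc
    obtain ⟨a, -, ha⟩ := Finset.mem_image.mp (enumB_mem _ hc i)
    obtain ⟨b, -, hb⟩ := Finset.mem_image.mp (enumB_mem _ hc j)
    simp only [← ha, ← hb, hg] at hij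
    rw [← ha, ← hb, hij]

/-- For a skew-symmetric principally unimodular `S` over `ℚ` and `A1 = (S | I)`, `A2 = (I | I)`:
(i) `(A1, A2)` is a Pfaffian pair with constant `1`, and (ii) `B ↦ B ∩ E` is a bijection from
the common bases of `(A1, A2)` onto the feasible sets of the regular delta-matroid `D(S)`. -/
theorem delta_matroid_pfaffian_pair {E : Type*} [Fintype E] [LinearOrder E]
    (S : Matrix E E ℚ) (hskew : Sᵀ = -S)
    (hPU : ∀ F : Finset E,
      (prinSub S F).det = -1 ∨ (prinSub S F).det = 0 ∨ (prinSub S F).det = 1) :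
    (∀ B : Finset (E ⊕ₗ E), B.card = Fintype.card E →
        (colSubE (augA1 S) B).det ≠ 0 → (colSubE augA2 B).det ≠ 0 →
        (colSubE (augA1 S) B).det * (colSubE augA2 B).det = 1)
    ∧ Set.BijOn leftPart
        {B : Finset (E ⊕ₗ E) | B.card = Fintype.card E ∧
          (colSubE (augA1 S) B).det ≠ 0 ∧ (colSubE augA2 B).det ≠ 0}
        {F : Finset E | (prinSub S F).det ≠ 0} := by
  refine ⟨?_, ?_, ?_, ?_⟩
  · intro B hB h1 h2
    obtain ⟨s, hs, e2, e1⟩ := key S B hB (inj_of_det B hB h2)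
    rw [e1] at h1
    have hne := right_ne_zero_of_mul h1
    have hnn : 0 ≤ (prinSub S (leftPart B)).det := by
      apply skew_det_rat
      ext i j
      exact congrFun (congrFun hskew i) j
    have hone : (prinSub S (leftPart B)).det = 1 := by
      rcases hPU (leftPart B) with h | h | h
      · rw [h] at hnn; norm_num at hnn
      · exact absurd h hne
      · exact h
    rw [e1, e2, hone, mul_one, hs]
  · rintro B ⟨hB, h1, h2⟩
    obtain ⟨s, hs, e2, e1⟩ := key S B hB (inj_of_det B hB h2)
    rw [e1] at h1
    exact right_ne_zero_of_mul h1
  · rintro B ⟨hB, h1, h2⟩ C ⟨hC, h3, h4⟩ hBC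
    ext q
    rcases hq : ofLex q with x | x
    · have hq' : q = toLex (Sum.inl x) := hq
      rw [hq', ← mem_leftPart, ← mem_leftPart, hBC]
    · have hq' : q = toLex (Sum.inr x) := hq
      rw [hq', mem_inr B hB (inj_of_det B hB h2), mem_inr C hC (inj_of_det C hC h4), hBC]
  · intro F hF
    obtain ⟨B, hB, rfl, hi⟩ := surjB F
    obtain ⟨s, hs, e2, e1⟩ := key S B hB hi
    have hs0 : s ≠ 0 := by rintro rfl; simp at hs
    refine ⟨B, ⟨hB, ?_, ?_⟩, rfl⟩
    · rw [e1]; exact mul_ne_zero hs0 hF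
    · rw [e2]; exact hs0
end

section
/- Let G = (V, E) be a finite directed graph given by maps tail, head : E → V, and fix a root r ∈ V. Let A be the V×E incidence matrix over ℚ with A_{v,e} = [v = tail e] − [v = head e], and R the V×E matrix with R_{v,e} = −[v = head e]; let A' and R' be the submatrices of A and R obtained by deleting the row r. Then for every B ⊆ E with |B| = |V| − 1 such that both A'[B] and R'[B] are nonsingular, det A'[B] · det R'[B] = 1; that is, the pair (A', R') is Pfaffian with constant 1. -/
open Matrix

/-- The incidence matrix of a directed graph: `A v e = [v = tail e] - [v = head e]`. -/
def incMat {V E : Type*} [DecidableEq V] (tail head : E → V) : Matrix V E ℚ :=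
  Matrix.of fun v e => (if v = tail e then 1 else 0) - (if v = head e then 1 else 0)

/-- The matrix `R` with `R v e = -[v = head e]`. -/
def headMat {V E : Type*} [DecidableEq V] (head : E → V) : Matrix V E ℚ :=
  Matrix.of fun v e => if v = head e then -1 else 0

theorem aux_tri {V : Type*} [Fintype V] [LinearOrder V] (r : V) (q : V → V) (hq : q r = r)
    (N : Matrix {v : V // v ≠ r} {v : V // v ≠ r} ℚ)
    (hN : ∀ v w, N v w = (if v = w then 1 else 0) - (if (v : V) = q w then 1 else 0))
    (hd : N.det ≠ 0) : N.det = 1 := by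
  classical
  have hfix : ∀ n, q^[n] r = r := fun n => Function.iterate_fixed hq n
  have hreach : ∀ w : V, ∃ n, q^[n] w = r := by
    by_contra! hcon
    obtain ⟨w0, hw0⟩ := hcon
    have hw0r : w0 ≠ r := hw0 0
    let f : V → ℚ := fun v => if ∀ n, q^[n] v ≠ r then 1 else 0
    have hfr : f r = 0 := by
      simp only [f]
      rw [if_neg]
      intro h
      exact h 0 rfl
    have hfq : ∀ w, w ≠ r → f (q w) = f w := by
      intro w hw
      simp only [f]
      congr 1
      apply propext
      constructor
      · intro h n
        cases n with
        | zero => exact hw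
        | succ n => exact h n
      · intro h n
        exact h (n + 1)
    apply hd
    apply Matrix.exists_vecMul_eq_zero_iff.mp
    refine ⟨fun v => f v, ?_, ?_⟩
    · intro h
      have := congrFun h ⟨w0, hw0r⟩
      simp only [f, Pi.zero_apply] at this
      rw [if_pos hw0] at this
      exact one_ne_zero this
    · ext w
      simp only [Matrix.vecMul, dotProduct, hN, mul_sub, Finset.sum_sub_distrib, Pi.zero_apply]
      have h1 : ∑ x : {v : V // v ≠ r}, f x * (if x = w then 1 else 0) = f w := by simp
      have h2 : ∑ x : {v : V // v ≠ r}, f x * (if (x : V) = q w then 1 else 0) = f (q w) := by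
        by_cases h : q w = r
        · rw [h, hfr]
          apply Finset.sum_eq_zero
          intro x _
          rw [if_neg x.2, mul_zero]
        · rw [Finset.sum_eq_single (⟨q w, h⟩ : {v : V // v ≠ r})]
          · simp
          · intro b _ hb
            rw [if_neg, mul_zero]
            intro h'
            exact hb (Subtype.ext h')
          · simp
      rw [h1, h2, hfq w w.2, sub_self]
  let d : V → ℕ := fun v => Nat.find (hreach v)
  have hdlt : ∀ w, w ≠ r → d (q w) < d w := by
    intro w hw
    have hs : q^[d w] w = r := Nat.find_spec (hreach w)
    have hpos : d w ≠ 0 := by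
      intro h
      rw [h] at hs
      exact hw hs
    obtain ⟨m, hm⟩ := Nat.exists_eq_succ_of_ne_zero hpos
    rw [hm] at hs ⊢
    exact Nat.lt_succ_of_le (Nat.find_min' (hreach (q w)) hs)
  have hbt : N.BlockTriangular (fun v => d v) := by
    intro i j hij
    rw [hN, if_neg, if_neg, sub_zero]
    · intro h
      have := hdlt j j.2
      rw [← h] at this
      exact absurd hij (not_lt.mpr this.le)
    · rintro rfl
      exact lt_irrefl _ hij
  rw [hbt.det]
  apply Finset.prod_eq_one
  intro a _
  have : N.toSquareBlock (fun v => d v) a = 1 := by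
    ext i j
    simp only [Matrix.toSquareBlock_def, Matrix.of_apply, hN, Matrix.one_apply]
    rw [if_neg (c := ((i : {v : V // v ≠ r}) : V) = _), sub_zero]
    · simp [Subtype.ext_iff]
    · intro h
      have := hdlt j.1 j.1.2
      rw [← h] at this
      have h1 := i.2
      have h2 := j.2
      exact absurd this (by rw [h1, h2]; exact lt_irrefl _)
  rw [this, Matrix.det_one]

theorem aux_main {V : Type*} [Fintype V] [LinearOrder V] (r : V)
    (t h : {v : V // v ≠ r} → V) (M H : Matrix {v : V // v ≠ r} {v : V // v ≠ r} ℚ)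
    (hM : ∀ v i, M v i = (if (v : V) = t i then 1 else 0) - (if (v : V) = h i then 1 else 0))
    (hH : ∀ v i, H v i = if (v : V) = h i then -1 else 0)
    (hMd : M.det ≠ 0) (hHd : H.det ≠ 0) : M.det * H.det = 1 := by
  classical
  have hr : ∀ i, h i ≠ r := by
    intro i hi
    apply hHd
    apply Matrix.det_eq_zero_of_column_eq_zero i
    intro v
    rw [hH, hi, if_neg v.2]
  let s : {v : V // v ≠ r} → {v : V // v ≠ r} := fun i => ⟨h i, hr i⟩
  have hs : Function.Surjective s := by
    intro v
    by_contra! hv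
    apply hHd
    apply Matrix.det_eq_zero_of_row_eq_zero v
    intro i
    rw [hH, if_neg]
    intro h'
    exact hv i (Subtype.ext h'.symm)
  let e := Equiv.ofBijective s (Finite.surjective_iff_bijective.mp hs)
  have he : ∀ (v : {v : V // v ≠ r}) i, (v : V) = h i ↔ i = e.symm v := by
    intro v i
    rw [Equiv.eq_symm_apply]
    constructor
    · intro h'
      exact Subtype.ext h'.symm
    · intro h'
      exact (congrArg Subtype.val h').symm
  let q : V → V := fun v => if hv : v ≠ r then t (e.symm ⟨v, hv⟩) else r
  have key : (M * Hᵀ).det = 1 := by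
    apply aux_tri r q (by simp [q])
    · intro v w
      rw [Matrix.mul_apply]
      simp only [Matrix.transpose_apply, hH, he w]
      rw [Finset.sum_eq_single (e.symm w)]
      · rw [hM]
        have hqw : q w = t (e.symm w) := by
          simp only [q]
          rw [dif_pos w.2]
        simp only [he v, hqw]
        simp only [EmbeddingLike.apply_eq_iff_eq, if_true, eq_comm (a := w)]
        ring
      · intro b _ hb
        rw [if_neg hb, mul_zero]
      · simp
    · rw [Matrix.det_mul, Matrix.det_transpose]
      exact mul_ne_zero hMd hHd
  rwa [Matrix.det_mul, Matrix.det_transpose] at key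

/-- For a finite directed graph with root `r`, the pair `(A', R')` obtained by deleting row `r`
from the incidence matrix `A` and from `R` is Pfaffian with constant `1`: for every
`B ⊆ E` with `|B| = |V| - 1` making both `A'[B]` and `R'[B]` nonsingular,
`det A'[B] * det R'[B] = 1`. -/
theorem arborescence_pair_pfaffian {V E : Type*} [Fintype V] [LinearOrder V]
    [Fintype E] [LinearOrder E] (tail head : E → V) (r : V) :
    ∀ B : Finset E, B.card = Fintype.card V - 1 →
      (colSubE ((incMat tail head).submatrix (fun v : {v : V // v ≠ r} => (v : V)) id) B).det ≠ 0 →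
      (colSubE ((headMat head).submatrix (fun v : {v : V // v ≠ r} => (v : V)) id) B).det ≠ 0 →
      (colSubE ((incMat tail head).submatrix (fun v : {v : V // v ≠ r} => (v : V)) id) B).det *
        (colSubE ((headMat head).submatrix (fun v : {v : V // v ≠ r} => (v : V)) id) B).det
        = 1 := by
  intro B hB hM hH
  have hc : B.card = Fintype.card {v : V // v ≠ r} := by
    rw [hB, Fintype.card_subtype_compl, Fintype.card_subtype_eq]
  unfold colSubE at hM hH ⊢
  rw [dif_pos hc] at hM hH ⊢
  rw [dif_pos hc]
  exact aux_main r (fun i => tail (B.orderEmbOfFin hc ((Finset.univ.orderIsoOfFin Finset.card_univ).symm ⟨i, Finset.mem_univ i⟩)))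
    (fun i => head (B.orderEmbOfFin hc ((Finset.univ.orderIsoOfFin Finset.card_univ).symm ⟨i, Finset.mem_univ i⟩)))
    _ _ (fun v i => rfl) (fun v i => rfl) hM hH
end

section
/- Let G = (V, E) be a finite directed graph given by maps tail, head : E → V, and fix a root r ∈ V. Let A' and R' be the matrices over ℚ obtained from the incidence matrix A (A_{v,e} = [v = tail e] − [v = head e]) and from R (R_{v,e} = −[v = head e]) by deleting the row r. Then det(A' · R'ᵀ) equals the number of subsets B ⊆ E with |B| = |V| − 1 such that both A'[B] and R'[B] are nonsingular (with the cardinality cast into ℚ); these subsets are exactly the r-arborescences of G, so this is Tutte's directed matrix-tree theorem. -/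
open Matrix

theorem colSubE_det_ne {K : Type*} [CommRing K] {ι F : Type*} [Fintype ι] [LinearOrder ι]
    [Fintype F] [LinearOrder F] (A : Matrix ι F K) (f : ι → F) (hf : Function.Injective f) :
    (colSubE A (Finset.univ.image f)).det ≠ 0 ↔ (A.submatrix id f).det ≠ 0 := by
  have h : (Finset.univ.image f).card = Fintype.card ι := by
    rw [Finset.card_image_of_injective _ hf, Finset.card_univ]
  rw [colSubE, dif_pos h]
  set g : ι → F := fun i => (Finset.univ.image f).orderEmbOfFin h
    ((Finset.univ.orderIsoOfFin Finset.card_univ).symm ⟨i, Finset.mem_univ i⟩) with hg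
  have ginj : Function.Injective g := by
    intro a b hab
    simpa [hg] using hab
  have hmem : ∀ i, ∃ j, f j = g i := by
    intro i
    have := Finset.orderEmbOfFin_mem (Finset.univ.image f) h
      ((Finset.univ.orderIsoOfFin Finset.card_univ).symm ⟨i, Finset.mem_univ i⟩)
    obtain ⟨j, -, hj⟩ := Finset.mem_image.mp this
    exact ⟨j, hj⟩
  choose s hs using hmem
  have sinj : Function.Injective s := fun a b hab => ginj (by rw [← hs, ← hs, hab])
  let σ : Equiv.Perm ι := Equiv.ofBijective s (Finite.injective_iff_bijective.mp sinj)
  have e : A.submatrix id g = (A.submatrix id f).submatrix id σ := by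
    ext i j
    simp [σ, hs]
  rw [e, Matrix.det_permute']
  rcases Int.units_eq_one_or (Equiv.Perm.sign σ) with h1 | h1 <;> simp [h1]

theorem det_fun_graph {W : Type*} [Fintype W] [DecidableEq W] (p : W → Option W)
    (M : Matrix W W ℚ)
    (hM : ∀ u w, M u w = (if u = w then 1 else 0) - (if some u = p w then 1 else 0)) :
    M.det = 0 ∨ M.det = 1 := by
  classical
  let q : Option W → Option W := fun o => o.bind p
  have qs : ∀ w, q (some w) = p w := fun w => rfl
  by_cases hall : ∀ w, ∃ k, q^[k] (some w) = none
  · right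
    let d : W → ℕ := fun w => Nat.find (hall w)
    have hd : ∀ u w, some u = p w → d u < d w := by
      intro u w huw
      have h1 := Nat.find_spec (hall w)
      have h0 : d w ≠ 0 := by
        intro h0
        change q^[d w] (some w) = none at h1
        rw [h0] at h1
        simp at h1
      obtain ⟨k, hk⟩ := Nat.exists_eq_succ_of_ne_zero h0
      change q^[d w] (some w) = none at h1
      rw [hk, Function.iterate_succ_apply, qs, ← huw] at h1
      have : d u ≤ k := Nat.find_min' (hall u) h1
      omega
    have ht : M.BlockTriangular d := by
      intro i j hij
      rw [hM, if_neg, if_neg]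
      · simp
      · intro h
        have := hd _ _ h
        omega
      · rintro rfl
        exact lt_irrefl _ hij
    rw [ht.det]
    refine Finset.prod_eq_one fun a _ => ?_
    have : M.toSquareBlock d a = 1 := by
      ext i j
      rw [Matrix.toSquareBlock_def, Matrix.of_apply, hM, Matrix.one_apply]
      rw [if_neg (c := some i.1 = p j.1)]
      · simp [Subtype.ext_iff]
      · intro h
        have := hd _ _ h
        have h1 := i.2
        have h2 := j.2
        omega
    rw [this, Matrix.det_one]
  · left
    push Not at hall
    obtain ⟨w0, hw0⟩ := hall
    rw [← Matrix.exists_vecMul_eq_zero_iff]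
    refine ⟨fun w => if ∃ k, q^[k] (some w) = none then 0 else 1, ?_, ?_⟩
    · intro h
      have := congrFun h w0
      simp [hw0] at this
    · ext w
      have key : (∃ k, q^[k] (some w) = none) ↔ (∃ k, q^[k] (p w) = none) := by
        constructor
        · rintro ⟨k, hk⟩
          cases k with
          | zero => simp at hk
          | succ k => exact ⟨k, by rwa [Function.iterate_succ_apply, qs] at hk⟩
        · rintro ⟨k, hk⟩
          exact ⟨k + 1, by rwa [Function.iterate_succ_apply, qs]⟩
      simp only [Matrix.vecMul, dotProduct, hM, mul_sub, Finset.sum_sub_distrib, mul_ite, mul_one,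
        mul_zero, Finset.sum_ite_eq', Finset.mem_univ, if_true, Pi.zero_apply]
      rw [if_congr key rfl rfl]
      rcases hp : p w with _ | u
      · have : ∃ k, q^[k] none = none := ⟨0, rfl⟩
        simp [this]
      · simp

theorem det_expand_s12 {W E : Type*} [Fintype W] [DecidableEq W] [Fintype E] [DecidableEq E]
    (A R : Matrix W E ℚ) :
    (A * Rᵀ).det = ∑ f : W → E, (∏ w, R w (f w)) * (A.submatrix id f).det := by
  have h : (A * Rᵀ)ᵀ = fun w => ∑ e, R w e • Aᵀ e := by
    ext w u
    simp [Matrix.mul_apply, mul_comm]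
  rw [← Matrix.det_transpose, h]
  have := (Matrix.detRowAlternating (n := W) (R := ℚ)).toMultilinearMap.map_sum
    (fun w e => R w e • Aᵀ e)
  refine this.trans (Finset.sum_congr rfl fun f _ => ?_)
  rw [MultilinearMap.map_smul_univ, smul_eq_mul, ← Matrix.det_transpose (A.submatrix id f)]
  rfl

/-- Tutte's directed matrix-tree theorem: for a finite directed graph with root `r`, with `A'`
and `R'` obtained from the incidence matrix `A` and from `R` by deleting row `r`,
`det (A' * R'ᵀ)` equals the number of subsets `B ⊆ E` with `|B| = |V| - 1` such that both
`A'[B]` and `R'[B]` are nonsingular (these subsets are exactly the `r`-arborescences). -/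
theorem directed_matrix_tree {V E : Type*} [Fintype V] [LinearOrder V]
    [Fintype E] [LinearOrder E] (tail head : E → V) (r : V) :
    ((incMat tail head).submatrix (fun v : {v : V // v ≠ r} => (v : V)) id *
        ((headMat head).submatrix (fun v : {v : V // v ≠ r} => (v : V)) id)ᵀ).det
      = (((Finset.univ : Finset (Finset E)).filter
          (fun B => B.card = Fintype.card V - 1 ∧
            (colSubE ((incMat tail head).submatrix
                (fun v : {v : V // v ≠ r} => (v : V)) id) B).det ≠ 0 ∧
            (colSubE ((headMat head).submatrix
                (fun v : {v : V // v ≠ r} => (v : V)) id) B).det ≠ 0)).card : ℚ) := by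
  classical
  set A := (incMat tail head).submatrix (fun v : {v : V // v ≠ r} => (v : V)) id with hA
  set R := (headMat head).submatrix (fun v : {v : V // v ≠ r} => (v : V)) id with hR
  have Rv : ∀ w e, R w e = if (w : V) = head e then -1 else 0 := fun w e => rfl
  have Av : ∀ w e, A w e = (if (w : V) = tail e then 1 else 0) -
    (if (w : V) = head e then 1 else 0) := fun w e => rfl
  have hcard : Fintype.card V - 1 = Fintype.card {v : V // v ≠ r} := by
    simp [Fintype.card_subtype_compl]
  have hinj : ∀ f : {v : V // v ≠ r} → E, (∀ w : {v : V // v ≠ r}, (w : V) = head (f w)) → Function.Injective f := by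
    intro f hf a b hab
    apply Subtype.ext
    rw [hf a, hf b, hab]
  have term : ∀ f : {v : V // v ≠ r} → E, (∏ w, R w (f w)) * (A.submatrix id f).det =
      if (∀ w : {v : V // v ≠ r}, (w : V) = head (f w)) ∧ (A.submatrix id f).det ≠ 0 then 1 else 0 := by
    intro f
    by_cases hf : ∀ w : {v : V // v ≠ r}, (w : V) = head (f w)
    · have h1 : (∏ w, R w (f w)) * (A.submatrix id f).det = (-(A.submatrix id f)).det := by
        rw [Matrix.det_neg]
        congr 1
        rw [Finset.prod_congr rfl (fun w _ => show R w (f w) = -1 by rw [Rv, if_pos (hf w)])]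
        simp
      have h2 := det_fun_graph
        (fun w => if h : tail (f w) ≠ r then some ⟨tail (f w), h⟩ else none)
        (-(A.submatrix id f)) (by
          intro u w
          rw [Matrix.neg_apply, Matrix.submatrix_apply, Av, id, ← hf w, neg_sub]
          congr 1
          · simp [Subtype.ext_iff]
          · by_cases h : tail (f w) = r
            · have : (u : V) ≠ tail (f w) := by rw [h]; exact u.2
              simp [h, u.2]
            · simp [h, Subtype.ext_iff])
      rw [← h1] at h2
      by_cases h0 : (A.submatrix id f).det = 0
      · simp [h0]
      · rw [if_pos ⟨hf, h0⟩]
        refine h2.resolve_left ?_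
        refine mul_ne_zero (Finset.prod_ne_zero_iff.mpr fun w _ => ?_) h0
        rw [Rv, if_pos (hf w)]
        norm_num
    · rw [if_neg (fun h => hf h.1)]
      push Not at hf
      obtain ⟨w, hw⟩ := hf
      rw [Finset.prod_eq_zero (Finset.mem_univ w) (by rw [Rv, if_neg hw]), zero_mul]
  rw [det_expand_s12, Finset.sum_congr rfl fun f _ => term f, Finset.sum_boole]
  congr 1
  refine Finset.card_bij (fun f _ => Finset.univ.image f) ?_ ?_ ?_
  · intro f hf
    obtain ⟨hf, h0⟩ := (Finset.mem_filter.mp hf).2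
    have hi := hinj f hf
    refine Finset.mem_filter.mpr ⟨Finset.mem_univ _, ?_, ?_, ?_⟩
    · rw [Finset.card_image_of_injective _ hi, Finset.card_univ, hcard]
    · exact (colSubE_det_ne A f hi).mpr h0
    · refine (colSubE_det_ne R f hi).mpr ?_
      have : R.submatrix id f = -1 := by
        ext u w
        rw [Matrix.submatrix_apply, Rv, ← hf w, Matrix.neg_apply, Matrix.one_apply]
        by_cases h : u = w
        · simp [h]
        · have h' : (u : V) ≠ w := fun h' => h (Subtype.ext h')
          simp [h, h']
      rw [this, Matrix.det_neg]
      refine mul_ne_zero (pow_ne_zero _ (by norm_num)) ?_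
      convert (one_ne_zero : (1 : ℚ) ≠ 0)
      convert Matrix.det_one (n := {v : V // v ≠ r}) (R := ℚ)
  · intro f hf g hg hfg
    have hf := (Finset.mem_filter.mp hf).2.1
    have hg := (Finset.mem_filter.mp hg).2.1
    funext w
    have : f w ∈ Finset.univ.image g := by
      rw [← hfg]
      exact Finset.mem_image_of_mem _ (Finset.mem_univ _)
    obtain ⟨w', -, hw'⟩ := Finset.mem_image.mp this
    have : w' = w := Subtype.ext (by rw [hg w', hf w, hw'])
    rw [← hw', this]
  · intro B hB
    obtain ⟨hc, hBA, hBR⟩ := (Finset.mem_filter.mp hB).2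
    rw [hcard] at hc
    have hex : ∀ w : {v : V // v ≠ r}, ∃ e ∈ B, (w : V) = head e := by
      intro w
      by_contra hno
      push Not at hno
      apply hBR
      rw [colSubE, dif_pos hc]
      refine Matrix.det_eq_zero_of_row_eq_zero w fun j => ?_
      rw [Matrix.submatrix_apply, Rv, if_neg]
      exact hno _ (Finset.orderEmbOfFin_mem B hc _)
    choose f hfB hf using hex
    have hi := hinj f hf
    have hfe : Finset.univ.image f = B := by
      apply Finset.eq_of_subset_of_card_le
      · intro e he
        obtain ⟨w, -, rfl⟩ := Finset.mem_image.mp he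
        exact hfB w
      · rw [Finset.card_image_of_injective _ hi, Finset.card_univ, hc]
    refine ⟨f, Finset.mem_filter.mpr ⟨Finset.mem_univ _, hf, ?_⟩, hfe⟩
    rw [← hfe] at hBA
    exact (colSubE_det_ne A f hi).mp hBA
end

section
/- (Lindström–Gessel–Viennot lemma.) Let (V, E) be a finite acyclic directed graph given by maps tail, head : E → V, let k ≥ 0, and let s, t : Fin k → V be injective with disjoint images such that each vertex s(i) has in-degree 0 and each vertex t(j) has out-degree 0. Let R be a commutative ring and z : E → R. Define Ω : Matrix (Fin k) (Fin k) R by Ω(i, j) = Σ_{P a directed path from s(i) to t(j)} ∏_{e ∈ P} z_e (a finite sum, since the graph is acyclic). Then det Ω = Σ_{(σ, (P_1,…,P_k))} sgn σ · ∏_{i=1}^{k} ∏_{e ∈ P_i} z_e, where the sum is over all permutations σ of Fin k and all k-tuples of pairwise vertex-disjoint directed paths with P_i going from s(i) to t(σ(i)). -/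
open Matrix

variable {V E : Type*}

/-- `IsWalkFrom tail head a b p` says that the list of edges `p` forms a directed walk from
`a` to `b`: the empty list is a walk from `a` to `a`, and `e :: p` is a walk from `a` to `b`
iff `tail e = a` and `p` is a walk from `head e` to `b`. -/
def IsWalkFrom (tail head : E → V) : V → V → List E → Prop
  | a, b, [] => a = b
  | a, b, e :: p => tail e = a ∧ IsWalkFrom tail head (head e) b p

/-- The list of vertices visited by a walk starting at `a` with edge list `p`. -/
def walkVerts (head : E → V) (a : V) (p : List E) : List V := a :: p.map head

/-- A directed path from `a` to `b`: a walk all of whose visited vertices are distinct. -/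
def IsPath (tail head : E → V) (a b : V) (p : List E) : Prop :=
  IsWalkFrom tail head a b p ∧ (walkVerts head a p).Nodup

section LGVHelpers

open Classical in
/-- The part of a walk before the first visit of `v`. -/
noncomputable def lgvPre (head : E → V) (v : V) : V → List E → List E
  | _, [] => []
  | a, e :: p => if a = v then [] else e :: lgvPre head v (head e) p

open Classical in
/-- The part of a walk after the first visit of `v`. -/
noncomputable def lgvPost (head : E → V) (v : V) : V → List E → List E
  | _, [] => []
  | a, e :: p => if a = v then e :: p else lgvPost head v (head e) p

theorem lgv_pre_post (head : E → V) (v a : V) (p : List E) :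
    lgvPre head v a p ++ lgvPost head v a p = p := by
  induction p generalizing a with
  | nil => simp [lgvPre, lgvPost]
  | cons e p ih =>
    by_cases h : a = v
    · simp [lgvPre, lgvPost, h]
    · simp [lgvPre, lgvPost, h, ih]

theorem lgv_walk_split (tail head : E → V) (v a b : V) (p : List E)
    (hv : v ∈ walkVerts head a p) (hp : IsWalkFrom tail head a b p) :
    IsWalkFrom tail head a v (lgvPre head v a p) ∧
      IsWalkFrom tail head v b (lgvPost head v a p) := by
  induction p generalizing a with
  | nil =>
    simp [walkVerts] at hv
    subst hv
    simpa [lgvPre, lgvPost, IsWalkFrom] using hp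
  | cons e p ih =>
    by_cases h : a = v
    · subst h
      simpa [lgvPre, lgvPost, IsWalkFrom] using hp
    · have hv' : v ∈ walkVerts head (head e) p := by
        simp only [walkVerts, List.map_cons, List.mem_cons] at hv ⊢
        rcases hv with hv | hv
        · exact absurd hv.symm h
        · exact hv
      have := ih (head e) hv' hp.2
      simp only [lgvPre, lgvPost, h, if_false, IsWalkFrom]
      exact ⟨⟨hp.1, this.1⟩, this.2⟩

theorem lgv_walk_append (tail head : E → V) (a b c : V) (p q : List E)
    (hp : IsWalkFrom tail head a b p) (hq : IsWalkFrom tail head b c q) :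
    IsWalkFrom tail head a c (p ++ q) := by
  induction p generalizing a with
  | nil =>
    have : a = b := hp
    subst this
    exact hq
  | cons e p ih => exact ⟨hp.1, ih _ hp.2⟩

theorem lgv_cut (head : E → V) (v a : V) (p q : List E) (hv : v ∈ walkVerts head a p) :
    lgvPre head v a (lgvPre head v a p ++ q) = lgvPre head v a p ∧
      lgvPost head v a (lgvPre head v a p ++ q) = q ∧
      v ∈ walkVerts head a (lgvPre head v a p ++ q) := by
  induction p generalizing a with
  | nil =>
    simp [walkVerts] at hv
    subst hv
    cases q <;> simp [lgvPre, lgvPost, walkVerts]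
  | cons e p ih =>
    by_cases h : a = v
    · subst h
      cases q <;> simp [lgvPre, lgvPost, walkVerts]
    · have hv' : v ∈ walkVerts head (head e) p := by
        simp only [walkVerts, List.map_cons, List.mem_cons] at hv ⊢
        rcases hv with hv | hv
        · exact absurd hv.symm h
        · exact hv
      obtain ⟨h1, h2, h3⟩ := ih (head e) hv'
      simp only [lgvPre, lgvPost, h, if_false, List.cons_append]
      refine ⟨by rw [h1], h2, ?_⟩
      simp only [walkVerts, List.map_cons, List.mem_cons] at h3 ⊢
      exact Or.inr h3

theorem lgv_nodup (tail head : E → V)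
    (hacyclic : ∀ (a : V) (p : List E), p ≠ [] → ¬ IsWalkFrom tail head a a p)
    (a b : V) (p : List E) (hp : IsWalkFrom tail head a b p) :
    (walkVerts head a p).Nodup := by
  induction p generalizing a with
  | nil => simp [walkVerts]
  | cons e p ih =>
    have h := ih _ hp.2
    have : walkVerts head a (e :: p) = a :: walkVerts head (head e) p := by simp [walkVerts]
    rw [this, List.nodup_cons]
    refine ⟨fun ha => ?_, h⟩
    have h2 := (lgv_walk_split tail head a _ _ p ha hp.2).1
    exact hacyclic a (e :: lgvPre head a (head e) p) (by simp) ⟨hp.1, h2⟩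

theorem lgv_finite [Fintype V] [Fintype E] (tail head : E → V) (a b : V) :
    {p : List E | IsPath tail head a b p}.Finite := by
  refine (List.finite_length_le E (Fintype.card V)).subset ?_
  intro p hp
  have := hp.2.length_le_card
  simp [walkVerts] at this
  simp only [Set.mem_ofPred_eq]
  omega

open Classical in
/-- Number of paths visiting `w`, with multiplicity. -/
noncomputable def lgvN {k : ℕ} (head : E → V) (s : Fin k → V) (P : Fin k → List E) (w : V) : ℕ :=
  ∑ i, (walkVerts head (s i) (P i)).count w

/-- Swap of tails along `τ` at `v`. -/
noncomputable def lgvSwap {k : ℕ} (head : E → V) (s : Fin k → V) (v : V)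
    (τ : Equiv.Perm (Fin k)) (P : Fin k → List E) : Fin k → List E :=
  fun i => lgvPre head v (s i) (P i) ++ lgvPost head v (s (τ i)) (P (τ i))

theorem lgvN_swap {k : ℕ} (head : E → V) (s : Fin k → V) (v : V)
    (τ : Equiv.Perm (Fin k)) (P : Fin k → List E) :
    lgvN head s (lgvSwap head s v τ P) = lgvN head s P := by
  classical
  funext w
  have key : ∀ τ : Equiv.Perm (Fin k), lgvN head s (lgvSwap head s v τ P) w =
      ∑ i, (s i :: (lgvPre head v (s i) (P i)).map head).count w +
        ∑ i, ((lgvPost head v (s i) (P i)).map head).count w := by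
    intro τ
    rw [← Equiv.sum_comp τ (fun i => ((lgvPost head v (s i) (P i)).map head).count w),
      ← Finset.sum_add_distrib]
    unfold lgvN
    refine Finset.sum_congr rfl fun i _ => ?_
    rw [← List.count_append]
    simp only [lgvSwap, walkVerts, List.map_append, List.cons_append]
  have h1 : lgvSwap head s v 1 P = P := by
    funext i
    simp [lgvSwap, lgv_pre_post]
  rw [key τ, ← key 1, h1]

theorem lgv_weight_swap {k : ℕ} (head : E → V) (s : Fin k → V) (v : V)
    (τ : Equiv.Perm (Fin k)) (P : Fin k → List E) {R : Type*} [CommRing R] (z : E → R) :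
    ∏ i, ((lgvSwap head s v τ P i).map z).prod = ∏ i, ((P i).map z).prod := by
  have key : ∀ τ : Equiv.Perm (Fin k), ∏ i, ((lgvSwap head s v τ P i).map z).prod =
      (∏ i, ((lgvPre head v (s i) (P i)).map z).prod) *
        ∏ i, ((lgvPost head v (s i) (P i)).map z).prod := by
    intro τ
    rw [← Equiv.prod_comp τ (fun i => ((lgvPost head v (s i) (P i)).map z).prod),
      ← Finset.prod_mul_distrib]
    refine Finset.prod_congr rfl fun i _ => ?_
    simp [lgvSwap]
  have h1 : lgvSwap head s v 1 P = P := by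
    funext i
    simp [lgvSwap, lgv_pre_post]
  rw [key τ, ← key 1, h1]

theorem lgvSwap_of_ne {k : ℕ} (head : E → V) (s : Fin k → V) (v : V) (i j l : Fin k)
    (P : Fin k → List E) (hi : l ≠ i) (hj : l ≠ j) :
    lgvSwap head s v (Equiv.swap i j) P l = P l := by
  simp [lgvSwap, Equiv.swap_apply_of_ne_of_ne hi hj, lgv_pre_post]

/-- The indices of the paths visiting `v`. -/
def lgvI {k : ℕ} (head : E → V) (s : Fin k → V) (P : Fin k → List E) (v : V) : Set (Fin k) :=
  {i | v ∈ walkVerts head (s i) (P i)}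

theorem lgvSwap_cut {k : ℕ} (head : E → V) (s : Fin k → V) (v : V) (i j : Fin k)
    (P : Fin k → List E) (hi : i ∈ lgvI head s P v) (hj : j ∈ lgvI head s P v) :
    lgvI head s (lgvSwap head s v (Equiv.swap i j) P) v = lgvI head s P v ∧
    lgvSwap head s v (Equiv.swap i j) (lgvSwap head s v (Equiv.swap i j) P) = P := by
  set τ := Equiv.swap i j with hτ
  have hc : ∀ l, (l = i ∨ l = j) → l ∈ lgvI head s P v := by
    rintro l (rfl | rfl) <;> assumption
  have hcut := fun l (hl : l = i ∨ l = j) =>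
    lgv_cut head v (s l) (P l) (lgvPost head v (s (τ l)) (P (τ l))) (hc l hl)
  constructor
  · ext l
    by_cases hl : l = i ∨ l = j
    · exact iff_of_true (hcut l hl).2.2 (hc l hl)
    · push Not at hl
      simp only [lgvI, Set.mem_ofPred_eq]
      rw [lgvSwap_of_ne head s v i j l P hl.1 hl.2]
  · funext l
    by_cases hl : l = i ∨ l = j
    · have hl' : τ l = i ∨ τ l = j := by
        rcases hl with rfl | rfl
        · right; simp [hτ]
        · left; simp [hτ]
      have e1 := (hcut l hl).1
      have e2 := (hcut (τ l) hl').2.1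
      have : τ (τ l) = l := by simp [hτ]
      rw [this] at e2
      change lgvPre head v (s l) (lgvPre head v (s l) (P l) ++ _) ++
        lgvPost head v (s (τ l)) (lgvPre head v (s (τ l)) (P (τ l)) ++
          lgvPost head v (s (τ (τ l))) (P (τ (τ l)))) = P l
      rw [this, e1, e2, lgv_pre_post]
    · push Not at hl
      rw [lgvSwap_of_ne head s v i j l _ hl.1 hl.2, lgvSwap_of_ne head s v i j l _ hl.1 hl.2]

theorem lgvSwap_walk {k : ℕ} (tail head : E → V) (s t : Fin k → V) (v : V) (i j : Fin k)
    (σ : Equiv.Perm (Fin k))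
    (P : Fin k → List E) (hi : i ∈ lgvI head s P v) (hj : j ∈ lgvI head s P v)
    (hP : ∀ l, IsWalkFrom tail head (s l) (t (σ l)) (P l)) (l : Fin k) :
    IsWalkFrom tail head (s l) (t ((σ * Equiv.swap i j) l))
      (lgvSwap head s v (Equiv.swap i j) P l) := by
  by_cases hl : l = i ∨ l = j
  · have hc : ∀ l, (l = i ∨ l = j) → l ∈ lgvI head s P v := by
      rintro l (rfl | rfl) <;> assumption
    have hl' : Equiv.swap i j l = i ∨ Equiv.swap i j l = j := by
      rcases hl with rfl | rfl
      · right; simp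
      · left; simp
    exact lgv_walk_append tail head _ v _ _ _
      (lgv_walk_split tail head v _ _ _ (hc l hl) (hP l)).1
      (lgv_walk_split tail head v _ _ _ (hc _ hl') (hP _)).2
  · push Not at hl
    rw [lgvSwap_of_ne head s v i j l P hl.1 hl.2, Equiv.Perm.mul_apply,
      Equiv.swap_apply_of_ne_of_ne hl.1 hl.2]
    exact hP l

theorem lgv_two_le {k : ℕ} (head : E → V) (s : Fin k → V) (P : Fin k → List E)
    (hP : ∀ i, (walkVerts head (s i) (P i)).Nodup) (w : V) :
    2 ≤ lgvN head s P w ↔ ∃ i j, i ∈ lgvI head s P w ∧ j ∈ lgvI head s P w ∧ i ≠ j := by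
  classical
  have : lgvN head s P w =
      (Finset.univ.filter fun i => w ∈ walkVerts head (s i) (P i)).card := by
    rw [Finset.card_filter]
    unfold lgvN
    refine Finset.sum_congr rfl fun i _ => ?_
    rw [← List.Nodup.count (hP i)]
  rw [this, ← Nat.lt_iff_add_one_le, Finset.one_lt_card]
  simp only [Finset.mem_filter, Finset.mem_univ, true_and, lgvI, Set.mem_ofPred_eq]
  constructor
  · rintro ⟨a, ha, b, hb, hab⟩
    exact ⟨a, b, ha, hb, hab⟩
  · rintro ⟨a, b, ha, hb, hab⟩
    exact ⟨a, ha, b, hb, hab⟩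

open Classical in
/-- Canonical vertex. -/
noncomputable def lgvV (v₀ : V) (N : V → ℕ) : V :=
  if h : ∃ w, 2 ≤ N w then h.choose else v₀

open Classical in
/-- Canonical transposition. -/
noncomputable def lgvT {k : ℕ} (I : Set (Fin k)) : Equiv.Perm (Fin k) :=
  if h : ∃ ij : Fin k × Fin k, ij.1 ∈ I ∧ ij.2 ∈ I ∧ ij.1 ≠ ij.2 then
    Equiv.swap h.choose.1 h.choose.2 else 1

theorem lgvT_spec {k : ℕ} (I : Set (Fin k)) (h : ∃ i j, i ∈ I ∧ j ∈ I ∧ i ≠ j) :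
    ∃ i j, i ∈ I ∧ j ∈ I ∧ i ≠ j ∧ lgvT I = Equiv.swap i j := by
  have h' : ∃ ij : Fin k × Fin k, ij.1 ∈ I ∧ ij.2 ∈ I ∧ ij.1 ≠ ij.2 := by
    obtain ⟨i, j, h⟩ := h
    exact ⟨(i, j), h⟩
  refine ⟨h'.choose.1, h'.choose.2, h'.choose_spec.1, h'.choose_spec.2.1,
    h'.choose_spec.2.2, ?_⟩
  simp only [lgvT, dif_pos h']

/-- Canonical transposition of a tuple. -/
noncomputable def lgvTau {k : ℕ} (head : E → V) (s : Fin k → V) (v₀ : V) (P : Fin k → List E) :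
    Equiv.Perm (Fin k) :=
  lgvT (lgvI head s P (lgvV v₀ (lgvN head s P)))

/-- The sign-reversing involution. -/
noncomputable def lgvG {k : ℕ} (head : E → V) (s : Fin k → V) (v₀ : V)
    (x : Equiv.Perm (Fin k) × (Fin k → List E)) : Equiv.Perm (Fin k) × (Fin k → List E) :=
  (x.1 * lgvTau head s v₀ x.2,
    lgvSwap head s (lgvV v₀ (lgvN head s x.2)) (lgvTau head s v₀ x.2) x.2)

theorem lgvG_spec {k : ℕ} (tail head : E → V)
    (hacyclic : ∀ (a : V) (p : List E), p ≠ [] → ¬ IsWalkFrom tail head a a p)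
    (s t : Fin k → V) (v₀ : V) (x : Equiv.Perm (Fin k) × (Fin k → List E))
    (hP : ∀ l, IsWalkFrom tail head (s l) (t (x.1 l)) (x.2 l))
    (hN : ∃ w, 2 ≤ lgvN head s x.2 w) :
    (∀ l, IsWalkFrom tail head (s l) (t ((lgvG head s v₀ x).1 l)) ((lgvG head s v₀ x).2 l)) ∧
    (∃ w, 2 ≤ lgvN head s (lgvG head s v₀ x).2 w) ∧
    lgvG head s v₀ (lgvG head s v₀ x) = x ∧
    Equiv.Perm.sign (lgvG head s v₀ x).1 = - Equiv.Perm.sign x.1 := by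
  obtain ⟨σ, P⟩ := x
  dsimp only at hP hN
  set v := lgvV v₀ (lgvN head s P) with hv
  have hv2 : 2 ≤ lgvN head s P v := by
    rw [hv, lgvV, dif_pos hN]
    exact hN.choose_spec
  obtain ⟨i, j, hi, hj, hij, hT⟩ := lgvT_spec _
    ((lgv_two_le head s P (fun l => lgv_nodup tail head hacyclic _ _ _ (hP l)) v).1 hv2)
  have hτ : lgvTau head s v₀ P = Equiv.swap i j := hT
  obtain ⟨c1, c2⟩ := lgvSwap_cut head s v i j P hi hj
  have hG : lgvG head s v₀ (σ, P) =
      (σ * Equiv.swap i j, lgvSwap head s v (Equiv.swap i j) P) := by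
    simp only [lgvG, hτ, hv]
  have hNs := lgvN_swap head s v (Equiv.swap i j) P
  have hτ' : lgvTau head s v₀ (lgvSwap head s v (Equiv.swap i j) P) = Equiv.swap i j := by
    rw [lgvTau, hNs, ← hv, c1, hT]
  rw [hG]
  refine ⟨lgvSwap_walk tail head s t v i j σ P hi hj hP, ?_, ?_, ?_⟩
  · dsimp only
    rw [hNs]
    exact hN
  · simp only [lgvG, hτ', hNs, ← hv, c2]
    simp [mul_assoc]
  · simp [Equiv.Perm.sign_swap hij]

end LGVHelpers

/-- The Lindström–Gessel–Viennot lemma: in a finite acyclic directed graph with sources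
`s 0, …, s (k-1)` (in-degree `0`) and sinks `t 0, …, t (k-1)` (out-degree `0`), the
determinant of the path-generating matrix `Ω` equals the signed sum, over all permutations
`σ` and all `k`-tuples of pairwise vertex-disjoint paths `P i : s i → t (σ i)`, of
`sgn σ * ∏ i ∏_{e ∈ P i} z e`. -/
theorem lindstrom_gessel_viennot [Fintype V] [Fintype E] {k : ℕ}
    (tail head : E → V)
    (hacyclic : ∀ (a : V) (p : List E), p ≠ [] → ¬ IsWalkFrom tail head a a p)
    (s t : Fin k → V) (hs : Function.Injective s) (ht : Function.Injective t)
    (hst : ∀ i j, s i ≠ t j)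
    (hsource : ∀ (i : Fin k) (e : E), head e ≠ s i)
    (hsink : ∀ (j : Fin k) (e : E), tail e ≠ t j)
    (R : Type*) [CommRing R] (z : E → R) :
    (Matrix.of fun i j : Fin k =>
        ∑ᶠ p ∈ {p : List E | IsPath tail head (s i) (t j) p}, ((p.map z).prod : R)).det
      = ∑ᶠ (σ : Equiv.Perm (Fin k)) (P : Fin k → List E)
          (_ : (∀ i, IsPath tail head (s i) (t (σ i)) (P i)) ∧
               ∀ i j, i ≠ j →
                 List.Disjoint (walkVerts head (s i) (P i)) (walkVerts head (s j) (P j))),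
          ((Equiv.Perm.sign σ : ℤ) : R) * ∏ i, ((P i).map z).prod := by
  classical
  have hpath : ∀ a b p, IsPath tail head a b p ↔ IsWalkFrom tail head a b p := fun a b p =>
    ⟨fun h => h.1, fun h => ⟨h, lgv_nodup tail head hacyclic a b p h⟩⟩
  set F : V → V → Finset (List E) := fun a b => (lgv_finite tail head a b).toFinset with hF
  have hFm : ∀ a b p, p ∈ F a b ↔ IsPath tail head a b p := by
    intro a b p
    simp [hF]
  set D : (Fin k → List E) → Prop := fun P => ∀ i j, i ≠ j →
    List.Disjoint (walkVerts head (s i) (P i)) (walkVerts head (s j) (P j)) with hD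
  set f : Equiv.Perm (Fin k) × (Fin k → List E) → R := fun x =>
    ((Equiv.Perm.sign x.1 : ℤ) : R) * ∏ i, ((x.2 i).map z).prod with hf
  set A : Equiv.Perm (Fin k) → Finset (Fin k → List E) := fun σ =>
    Fintype.piFinset fun i => F (s i) (t (σ i)) with hA
  have hAm : ∀ σ P, P ∈ A σ ↔ ∀ i, IsPath tail head (s i) (t (σ i)) (P i) := by
    intro σ P
    simp [hA, hFm]
  have hL : (Matrix.of fun i j : Fin k =>
        ∑ᶠ p ∈ {p : List E | IsPath tail head (s i) (t j) p}, ((p.map z).prod : R)).det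
      = ∑ σ : Equiv.Perm (Fin k), ∑ P ∈ A σ, f (σ, P) := by
    rw [← Matrix.det_transpose, Matrix.det_apply']
    refine Finset.sum_congr rfl fun σ _ => ?_
    simp only [Matrix.transpose_apply, Matrix.of_apply, hf, hA]
    rw [← Finset.mul_sum, ← Finset.prod_univ_sum (fun i => F (s i) (t (σ i)))
      (fun _ p => (p.map z).prod)]
    congr 1
    refine Finset.prod_congr rfl fun i _ => ?_
    rw [finsum_mem_eq_finite_toFinset_sum _ (lgv_finite tail head (s i) (t (σ i)))]
  have hR : (∑ᶠ (σ : Equiv.Perm (Fin k)) (P : Fin k → List E)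
          (_ : (∀ i, IsPath tail head (s i) (t (σ i)) (P i)) ∧ D P), f (σ, P))
      = ∑ σ : Equiv.Perm (Fin k), ∑ P ∈ (A σ).filter D, f (σ, P) := by
    rw [finsum_eq_sum_of_fintype]
    refine Finset.sum_congr rfl fun σ _ => ?_
    rw [← finsum_mem_finset_eq_sum]
    refine finsum_congr fun P => ?_
    have : P ∈ (A σ).filter D ↔
        (∀ i, IsPath tail head (s i) (t (σ i)) (P i)) ∧ D P := by
      rw [Finset.mem_filter, hAm]
    simp only [this]
  rw [hL]
  refine Eq.trans ?_ hR.symm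
  have hsplit : ∀ σ : Equiv.Perm (Fin k), ∑ P ∈ A σ, f (σ, P) =
      ∑ P ∈ (A σ).filter D, f (σ, P) + ∑ P ∈ (A σ).filter (fun P => ¬ D P), f (σ, P) :=
    fun σ => (Finset.sum_filter_add_sum_filter_not _ _ _).symm
  simp only [hsplit]
  rw [Finset.sum_add_distrib, add_eq_left]
  set B : Finset (Equiv.Perm (Fin k) × (Fin k → List E)) :=
    Finset.univ.biUnion fun σ => ((A σ).filter (fun P => ¬ D P)).image (Prod.mk σ) with hB
  have hDN : ∀ P : Fin k → List E, (∀ i, (walkVerts head (s i) (P i)).Nodup) →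
      (¬ D P ↔ ∃ w, 2 ≤ lgvN head s P w) := by
    intro P hP
    simp only [lgv_two_le head s P hP, hD, lgvI, List.Disjoint, Set.mem_ofPred_eq]
    push Not
    constructor
    · rintro ⟨i, j, hij, w, h1, h2, -⟩
      exact ⟨w, i, j, h1, h2, hij⟩
    · rintro ⟨w, i, j, h1, h2, hij⟩
      exact ⟨i, j, hij, w, h1, h2, trivial⟩
  have hBm : ∀ x, x ∈ B ↔ (∀ l, IsWalkFrom tail head (s l) (t (x.1 l)) (x.2 l)) ∧
      ∃ w, 2 ≤ lgvN head s x.2 w := by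
    rintro ⟨σ, P⟩
    have h1 : (σ, P) ∈ B ↔ P ∈ A σ ∧ ¬ D P := by
      simp [hB]
    rw [h1, hAm]
    simp only [hpath]
    refine and_congr_right fun h => ?_
    exact hDN P fun l => lgv_nodup tail head hacyclic _ _ _ (h l)
  have hBs : ∑ σ : Equiv.Perm (Fin k), ∑ P ∈ (A σ).filter (fun P => ¬ D P), f (σ, P)
      = ∑ x ∈ B, f x := by
    rw [hB, Finset.sum_biUnion]
    · refine Finset.sum_congr rfl fun σ _ => ?_
      rw [Finset.sum_image fun _ _ _ _ h => (Prod.mk.inj h).2]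
    · intro σ _ σ' _ hne
      simp only [Function.onFun]
      rw [Finset.disjoint_left]
      rintro ⟨a, b⟩ h1 h2
      simp only [Finset.mem_image, Prod.mk.injEq] at h1 h2
      obtain ⟨_, _, rfl, _⟩ := h1
      obtain ⟨_, _, rfl, _⟩ := h2
      exact hne rfl
  rw [hBs]
  rcases isEmpty_or_nonempty V with hV | ⟨⟨v₀⟩⟩
  · refine Finset.sum_eq_zero fun x hx => ?_
    obtain ⟨w, -⟩ := ((hBm x).1 hx).2
    exact hV.elim w
  refine Finset.sum_involution (fun x _ => lgvG head s v₀ x) ?_ ?_ ?_ ?_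
  · intro x hx
    obtain ⟨hw, hN⟩ := (hBm x).1 hx
    obtain ⟨-, -, -, h4⟩ := lgvG_spec tail head hacyclic s t v₀ x hw hN
    simp only [hf, h4]
    simp only [lgvG, lgv_weight_swap]
    push_cast
    ring
  · intro x hx _ heq
    obtain ⟨hw, hN⟩ := (hBm x).1 hx
    obtain ⟨-, -, -, h4⟩ := lgvG_spec tail head hacyclic s t v₀ x hw hN
    rw [heq] at h4
    rcases Int.units_eq_one_or (Equiv.Perm.sign x.1) with h | h <;> rw [h] at h4 <;>
      exact absurd h4 (by decide)
  · intro x hx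
    obtain ⟨hw, hN⟩ := (hBm x).1 hx
    obtain ⟨h1, h2, -, -⟩ := lgvG_spec tail head hacyclic s t v₀ x hw hN
    exact (hBm _).2 ⟨h1, h2⟩
  · intro x hx
    obtain ⟨hw, hN⟩ := (hBm x).1 hx
    exact (lgvG_spec tail head hacyclic s t v₀ x hw hN).2.2.1
end

section
/- Let K be a field, ι a finite type with |ι| = r, E a linearly ordered finite set, A : Matrix ι E K, and b : ι → E injective with A(i, b(i')) = [i = i'] for all i, i' ∈ ι (i.e., the columns indexed by B = b(ι) form an identity matrix). Let w : E → ℝ and suppose B is a minimum-weight base of A with respect to w, i.e., det A[B] ≠ 0 and w(B) ≤ w(S) for every S ⊆ E with |S| = r and det A[S] ≠ 0, where w(S) = Σ_{j∈S} w(j). Then for every i ∈ ι and j ∈ E, if A(i, j) ≠ 0 then w(b(i)) ≤ w(j). -/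
open Matrix

theorem colSubE_det_ne_aux {K : Type*} [Field K] {ι E : Type*} [Fintype ι] [LinearOrder ι]
    [Fintype E] [LinearOrder E] (A : Matrix ι E K) (c : ι → E) (hc : Function.Injective c)
    (h : (A.submatrix id c).det ≠ 0) : (colSubE A (Finset.univ.image c)).det ≠ 0 := by
  have hcard : (Finset.univ.image c).card = Fintype.card ι := by
    rw [Finset.card_image_of_injective _ hc, Finset.card_univ]
  unfold colSubE
  rw [dif_pos hcard]
  set e : ι → E := fun i => (Finset.univ.image c).orderEmbOfFin hcard
    ((Finset.univ.orderIsoOfFin Finset.card_univ).symm ⟨i, Finset.mem_univ i⟩) with he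
  have hinj : Function.Injective e := by
    intro x y hxy
    have h1 := ((Finset.univ.image c).orderEmbOfFin hcard).injective hxy
    have h2 := (OrderIso.injective _) h1
    exact congrArg Subtype.val h2
  have hmem : ∀ i, ∃ k, c k = e i := by
    intro i
    have := Finset.orderEmbOfFin_mem (Finset.univ.image c) hcard
      ((Finset.univ.orderIsoOfFin Finset.card_univ).symm ⟨i, Finset.mem_univ i⟩)
    obtain ⟨k, -, hk⟩ := Finset.mem_image.1 this
    exact ⟨k, hk⟩
  choose s hs using hmem
  have sinj : Function.Injective s := by
    intro x y hxy
    apply hinj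
    rw [← hs, ← hs, hxy]
  let σ : Equiv.Perm ι := Equiv.ofBijective s (Finite.injective_iff_bijective.1 sinj)
  have heq : A.submatrix id e = (A.submatrix id c).submatrix id σ := by
    ext x y
    simp [σ, hs]
  rw [heq, Matrix.det_permute']
  refine mul_ne_zero ?_ h
  rcases Int.units_eq_one_or (Equiv.Perm.sign σ) with h | h <;> simp [h]

/-- If the columns of `A` indexed by `B = b(ι)` form an identity matrix and `B` is a
minimum-weight base of `A` with respect to `w`, then every nonzero entry `A i j` satisfies
`w (b i) ≤ w j`. -/
theorem min_weight_base_entry {K : Type*} [Field K] {ι E : Type*} [Fintype ι] [LinearOrder ι]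
    [Fintype E] [LinearOrder E] (A : Matrix ι E K) (b : ι → E)
    (hb : Function.Injective b)
    (hA : ∀ i i' : ι, A i (b i') = if i = i' then 1 else 0)
    (w : E → ℝ)
    (hBbase : (colSubE A (Finset.univ.image b)).det ≠ 0)
    (hBmin : ∀ S : Finset E, S.card = Fintype.card ι → (colSubE A S).det ≠ 0 →
      ∑ j ∈ Finset.univ.image b, w j ≤ ∑ j ∈ S, w j) :
    ∀ (i : ι) (j : E), A i j ≠ 0 → w (b i) ≤ w j := by
  intro i j hij
  by_cases hj : ∃ k, b k = j
  · obtain ⟨k, rfl⟩ := hj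
    rw [hA] at hij
    have : i = k := by
      by_contra hne
      simp [hne] at hij
    rw [this]
  · push Not at hj
    have hc : Function.Injective (Function.update b i j) := by
      intro x y hxy
      by_cases hx : x = i <;> by_cases hy : y = i
      · rw [hx, hy]
      · subst hx
        simp [Function.update_of_ne hy] at hxy
        exact absurd hxy.symm (hj y)
      · subst hy
        simp [Function.update_of_ne hx] at hxy
        exact absurd hxy (hj x)
      · rw [Function.update_of_ne hx, Function.update_of_ne hy] at hxy
        exact hb hxy
    have hm : A.submatrix id (Function.update b i j)
        = (1 : Matrix ι ι K).updateCol i (fun x => A x j) := by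
      ext x y
      by_cases hy : y = i
      · subst hy; simp
      · simp [Matrix.updateCol_apply, hy, hA, Matrix.one_apply]
    have hdet : (A.submatrix id (Function.update b i j)).det ≠ 0 := by
      rw [hm, ← Matrix.cramer_apply, Matrix.cramer_one]
      exact hij
    have key := hBmin (Finset.univ.image (Function.update b i j))
      (by rw [Finset.card_image_of_injective _ hc, Finset.card_univ])
      (colSubE_det_ne_aux A _ hc hdet)
    rw [Finset.sum_image (fun x _ y _ h => hb h), Finset.sum_image (fun x _ y _ h => hc h),
      ← Finset.add_sum_erase _ _ (Finset.mem_univ i),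
      ← Finset.add_sum_erase _ (fun x => w (Function.update b i j x)) (Finset.mem_univ i)] at key
    have hs : ∑ x ∈ Finset.univ.erase i, w (Function.update b i j x)
        = ∑ x ∈ Finset.univ.erase i, w (b x) := by
      refine Finset.sum_congr rfl fun x hx => ?_
      rw [Function.update_of_ne (Finset.ne_of_mem_erase hx)]
    rw [hs] at key
    simp only [Function.update_self] at key
    linarith
end

section
/- Let (A1, A2) be an r×n matrix pair over a field K with column set E, let w : E → ℝ, and let B be a minimum-weight common base of (A1, A2) with respect to w such that A1[B] = A2[B] = I_r, identifying the row sets of A1 and A2 with B via injections b : ι → E with image B. Let w1, w2 : E → ℝ satisfy (W1) w1(j) + w2(j) = w(j) for all j ∈ E, and (W2) a common base B' minimizes w among common bases if and only if B' minimizes w1 among bases of A1 and B' minimizes w2 among bases of A2. For k = 1, 2 define A_k# by A_k#(u, j) = A_k(u, j) if w_k(u) = w_k(j) (u ∈ B) and 0 otherwise. Then a subset B' ⊆ E is a minimum-weight common base of (A1, A2) with respect to w if and only if B' is a common base of (A1#, A2#); moreover, for every such B', det A1#[B'] · det A2#[B'] = det A1[B'] · det A2[B']. -/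
open Matrix

/-- `S` is a base of `A`: it has the right cardinality and `A[S]` is nonsingular. -/
def IsBase {K : Type*} [CommRing K] {ι F : Type*} [Fintype ι] [LinearOrder ι]
    [Fintype F] [LinearOrder F] (A : Matrix ι F K) (S : Finset F) : Prop :=
  S.card = Fintype.card ι ∧ (colSubE A S).det ≠ 0

/-- `S` is a common base of the pair `(A1, A2)`. -/
def IsCommonBase {K : Type*} [CommRing K] {ι F : Type*} [Fintype ι] [LinearOrder ι]
    [Fintype F] [LinearOrder F] (A1 A2 : Matrix ι F K) (S : Finset F) : Prop :=
  IsBase A1 S ∧ IsBase A2 S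

/-- The matrix `A#` obtained from `A` by keeping the entry `A i j` when `w (b i) = w j` and
replacing it by `0` otherwise. -/
noncomputable def sharp {K : Type*} [CommRing K] {ι E : Type*} (A : Matrix ι E K)
    (b : ι → E) (w : E → ℝ) : Matrix ι E K :=
  Matrix.of fun i j => if w (b i) = w j then A i j else 0

theorem exists_enum {ι F : Type*} [Fintype ι] [LinearOrder ι]
    [Fintype F] [LinearOrder F] (B : Finset F) (h : B.card = Fintype.card ι) :
    ∃ c : ι → F, Function.Injective c ∧ Finset.univ.image c = B ∧
      ∀ {K : Type*} [CommRing K] (A : Matrix ι F K), colSubE A B = A.submatrix id c := by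
  have hinj : Function.Injective (fun i : ι =>
      B.orderEmbOfFin h ((Finset.univ.orderIsoOfFin Finset.card_univ).symm
        ⟨i, Finset.mem_univ i⟩)) := by
    intro i i' hii
    simpa using hii
  refine ⟨_, hinj, ?_, ?_⟩
  · apply Finset.eq_of_subset_of_card_le
    · intro x hx
      obtain ⟨i, -, rfl⟩ := Finset.mem_image.1 hx
      exact Finset.orderEmbOfFin_mem _ _ _
    · rw [Finset.card_image_of_injective _ hinj, h, Finset.card_univ]
  · intro K _ A
    unfold colSubE
    rw [dif_pos h]

theorem isBase_of_det {K : Type*} [Field K] {ι F : Type*} [Fintype ι] [LinearOrder ι]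
    [Fintype F] [LinearOrder F] (A : Matrix ι F K) (c : ι → F) (hc : Function.Injective c)
    (hd : (A.submatrix id c).det ≠ 0) : IsBase A (Finset.univ.image c) := by
  have hcard : (Finset.univ.image c).card = Fintype.card ι := by
    rw [Finset.card_image_of_injective _ hc, Finset.card_univ]
  refine ⟨hcard, ?_⟩
  obtain ⟨c', hc', him, hA⟩ := exists_enum _ hcard
  rw [hA]
  have hex : ∀ i, ∃ i', c' i' = c i := by
    intro i
    have : c i ∈ Finset.univ.image c' := by
      rw [him]; exact Finset.mem_image_of_mem _ (Finset.mem_univ _)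
    simpa using this
  choose s hs using hex
  have hsinj : Function.Injective s := by
    intro i i' h
    apply hc
    rw [← hs, ← hs, h]
  let σ : Equiv.Perm ι := Equiv.ofBijective s (Finite.injective_iff_bijective.1 hsinj)
  have he : A.submatrix id c = (A.submatrix id c').submatrix id σ := by
    ext i k
    simp [σ, hs]
  rw [he, Matrix.det_permute'] at hd
  exact right_ne_zero_of_mul hd

theorem entry_weight {K : Type*} [Field K] {ι E : Type*} [Fintype ι]
    [LinearOrder ι] [Fintype E] [LinearOrder E]
    (A : Matrix ι E K) (b : ι → E) (hb : Function.Injective b)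
    (hA : ∀ i i' : ι, A i (b i') = if i = i' then 1 else 0) (w : E → ℝ)
    (hmin : ∀ S : Finset E, IsBase A S → ∑ j ∈ Finset.univ.image b, w j ≤ ∑ j ∈ S, w j)
    (i : ι) (j : E) (hij : A i j ≠ 0) : w (b i) ≤ w j := by
  by_cases hj : ∃ i', b i' = j
  · obtain ⟨i', rfl⟩ := hj
    rw [hA] at hij
    have : i = i' := by by_contra h; simp [h] at hij
    rw [this]
  · push Not at hj
    have hinj : Function.Injective (Function.update b i j) := by
      intro x y hxy
      by_cases hx : x = i <;> by_cases hy : y = i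
      · rw [hx, hy]
      · subst hx; simp [hy] at hxy; exact absurd hxy.symm (hj y)
      · subst hy; simp [hx] at hxy; exact absurd hxy (hj x)
      · simp [hx, hy] at hxy; exact hb hxy
    have hm : A.submatrix id (Function.update b i j)
        = (1 : Matrix ι ι K).updateCol i (fun k => A k j) := by
      ext x y
      by_cases hy : y = i
      · subst hy; simp
      · simp [hy, hA, Matrix.one_apply]
    have hd : (A.submatrix id (Function.update b i j)).det ≠ 0 := by
      rw [hm, ← Matrix.cramer_apply, Matrix.cramer_one]
      exact hij
    have := hmin _ (isBase_of_det A _ hinj hd)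
    rw [Finset.sum_image hb.injOn, Finset.sum_image hinj.injOn,
      ← Finset.add_sum_erase _ _ (Finset.mem_univ i),
      ← Finset.add_sum_erase _ (fun x => w (Function.update b i j x)) (Finset.mem_univ i)] at this
    have h2 : ∑ x ∈ Finset.univ.erase i, w (Function.update b i j x)
        = ∑ x ∈ Finset.univ.erase i, w (b x) := by
      apply Finset.sum_congr rfl
      intro x hx
      rw [Function.update_of_ne (Finset.ne_of_mem_erase hx)]
    rw [h2] at this
    rw [Function.update_self] at this
    linarith

theorem sharp_key {K : Type*} [Field K] {ι E : Type*} [Fintype ι]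
    [LinearOrder ι] [Fintype E] [LinearOrder E]
    (A : Matrix ι E K) (b : ι → E) (hb : Function.Injective b)
    (hA : ∀ i i' : ι, A i (b i') = if i = i' then 1 else 0) (w : E → ℝ)
    (hmin : ∀ S : Finset E, IsBase A S → ∑ j ∈ Finset.univ.image b, w j ≤ ∑ j ∈ S, w j)
    (B : Finset E) (hB : B.card = Fintype.card ι) :
    ((colSubE (sharp A b w) B).det ≠ 0 → ∑ j ∈ B, w j = ∑ j ∈ Finset.univ.image b, w j) ∧
    (∑ j ∈ B, w j = ∑ j ∈ Finset.univ.image b, w j →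
      (colSubE (sharp A b w) B).det = (colSubE A B).det) := by
  obtain ⟨c, hc, rfl, hcol⟩ := exists_enum B hB
  rw [hcol, hcol, Finset.sum_image hb.injOn, Finset.sum_image hc.injOn,
    Matrix.det_apply, Matrix.det_apply]
  constructor
  · intro hd
    obtain ⟨σ, -, hσ⟩ := Finset.exists_ne_zero_of_sum_ne_zero hd
    have hp : ∏ i, ((sharp A b w).submatrix id c) (σ i) i ≠ 0 := by
      intro h; rw [h] at hσ; simp at hσ
    rw [Finset.prod_ne_zero_iff] at hp
    rw [← Equiv.sum_comp σ (fun i => w (b i))]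
    apply Finset.sum_congr rfl
    intro i hi
    have := hp i hi
    by_contra hne
    apply this
    simp [sharp, Ne.symm hne]
  · intro hw
    apply Finset.sum_congr rfl
    intro σ _
    congr 1
    by_cases hp : ∏ i, (A.submatrix id c) (σ i) i = 0
    · rw [hp]
      obtain ⟨i, hi, h0⟩ := Finset.prod_eq_zero_iff.1 hp
      apply Finset.prod_eq_zero hi
      have h0' : A (σ i) (c i) = 0 := h0
      simp [sharp, h0']
    · have hp' := Finset.prod_ne_zero_iff.1 hp
      have hle : ∀ i ∈ Finset.univ, w (b (σ i)) ≤ w (c i) := fun i hi =>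
        entry_weight A b hb hA w hmin _ _ (hp' i hi)
      rw [← Equiv.sum_comp σ (fun i => w (b i))] at hw
      have heq := (Finset.sum_eq_sum_iff_of_le hle).1 hw.symm
      apply Finset.prod_congr rfl
      intro i hi
      simp [sharp, heq i hi]

/-- Given a minimum-weight common base `B = b(ι)` of `(A1, A2)` with `A1[B] = A2[B] = I`, and
split weights `w1, w2` satisfying Frank's conditions (W1) and (W2), the minimum-weight common
bases of `(A1, A2)` are exactly the common bases of `(A1#, A2#)`, and on these
`det A1#[B'] * det A2#[B'] = det A1[B'] * det A2[B']`. -/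
theorem weight_splitting_sharp_pair {K : Type*} [Field K] {ι E : Type*} [Fintype ι]
    [LinearOrder ι] [Fintype E] [LinearOrder E]
    (A1 A2 : Matrix ι E K) (b : ι → E) (hb : Function.Injective b)
    (hA1 : ∀ i i' : ι, A1 i (b i') = if i = i' then 1 else 0)
    (hA2 : ∀ i i' : ι, A2 i (b i') = if i = i' then 1 else 0)
    (w w1 w2 : E → ℝ)
    (hBcb : IsCommonBase A1 A2 (Finset.univ.image b))
    (hBmin : ∀ S : Finset E, IsCommonBase A1 A2 S →
      ∑ j ∈ Finset.univ.image b, w j ≤ ∑ j ∈ S, w j)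
    (hW1 : ∀ j, w1 j + w2 j = w j)
    (hW2 : ∀ B' : Finset E, IsCommonBase A1 A2 B' →
      ((∀ S : Finset E, IsCommonBase A1 A2 S → ∑ j ∈ B', w j ≤ ∑ j ∈ S, w j) ↔
        ((∀ S : Finset E, IsBase A1 S → ∑ j ∈ B', w1 j ≤ ∑ j ∈ S, w1 j) ∧
         (∀ S : Finset E, IsBase A2 S → ∑ j ∈ B', w2 j ≤ ∑ j ∈ S, w2 j)))) :
    ∀ B' : Finset E,
      ((IsCommonBase A1 A2 B' ∧
          ∀ S : Finset E, IsCommonBase A1 A2 S → ∑ j ∈ B', w j ≤ ∑ j ∈ S, w j)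
        ↔ IsCommonBase (sharp A1 b w1) (sharp A2 b w2) B')
      ∧ (IsCommonBase (sharp A1 b w1) (sharp A2 b w2) B' →
          (colSubE (sharp A1 b w1) B').det * (colSubE (sharp A2 b w2) B').det
            = (colSubE A1 B').det * (colSubE A2 B').det) := by
  intro B'
  obtain ⟨hm1, hm2⟩ := (hW2 _ hBcb).1 hBmin
  have hw : ∀ S : Finset E, ∑ j ∈ S, w j = ∑ j ∈ S, w1 j + ∑ j ∈ S, w2 j := by
    intro S
    rw [← Finset.sum_add_distrib]
    exact Finset.sum_congr rfl fun j _ => (hW1 j).symm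
  have hback : IsCommonBase (sharp A1 b w1) (sharp A2 b w2) B' →
      (∑ j ∈ B', w j = ∑ j ∈ Finset.univ.image b, w j) ∧
      (colSubE (sharp A1 b w1) B').det = (colSubE A1 B').det ∧
      (colSubE (sharp A2 b w2) B').det = (colSubE A2 B').det := by
    rintro ⟨⟨hc, h1⟩, -, h2⟩
    obtain ⟨k1, l1⟩ := sharp_key A1 b hb hA1 w1 hm1 B' hc
    obtain ⟨k2, l2⟩ := sharp_key A2 b hb hA2 w2 hm2 B' hc
    exact ⟨by rw [hw, hw, k1 h1, k2 h2], l1 (k1 h1), l2 (k2 h2)⟩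
  refine ⟨⟨?_, ?_⟩, ?_⟩
  · rintro ⟨hcb, hmin⟩
    obtain ⟨n1, n2⟩ := (hW2 _ hcb).1 hmin
    have e1 := le_antisymm (n1 _ hBcb.1) (hm1 _ hcb.1)
    have e2 := le_antisymm (n2 _ hBcb.2) (hm2 _ hcb.2)
    have hc := hcb.1.1
    refine ⟨⟨hc, ?_⟩, hc, ?_⟩
    · rw [(sharp_key A1 b hb hA1 w1 hm1 B' hc).2 e1]
      exact hcb.1.2
    · rw [(sharp_key A2 b hb hA2 w2 hm2 B' hc).2 e2]
      exact hcb.2.2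
  · intro h
    obtain ⟨e, d1, d2⟩ := hback h
    refine ⟨⟨⟨h.1.1, ?_⟩, h.1.1, ?_⟩, ?_⟩
    · rw [← d1]; exact h.1.2
    · rw [← d2]; exact h.2.2
    · intro S hS
      rw [e]
      exact hBmin S hS
  · intro h
    obtain ⟨-, d1, d2⟩ := hback h
    rw [d1, d2]
end
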